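/- Under the framework assumptions on the structure of the system and on the data, assume in addition that there exists u_∞ ∈ H such that u − u_∞ ∈ L²(0,+∞;H), let (y,μ) be a solution of the fractional Cahn–Hilliard system, and suppose λ₁ = 0. Then for every element y_ω of the ω-limit set ω := {y_ω ∈ V_B^σ : y(t_n) → y_ω weakly in V_B^σ for some sequence t_n ↗ +∞} there exists a real-valued function μ_∞ ∈ L∞_loc([0,+∞)) such that (B^σ y_ω, B^σ(y_ω − v)) + ∫_Ω β̂(y_ω) + (π(y_ω) − u_∞, y_ω − v) ≤ (μ_∞(t), y_ω − v) + ∫_Ω β̂(v) for every v ∈ V_B^σ and a.a. t ∈ (0,+∞), where μ_∞(t) denotes the spatially constant function with value μ_∞(t). -/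

import Mathlib

noncomputable section

open MeasureTheory Filter Topology RealInnerProductSpace Set ENNReal NNReal

namespace FracCH

/-- The ambient space `ℝ³`. -/
abbrev E3 := EuclideanSpace ℝ (Fin 3)

/-- Lebesgue measure restricted to `Om`. -/
abbrev mOm (Om : Set E3) : Measure E3 := volume.restrict Om

/-- The Hilbert space `H = L²(Om)`. -/
abbrev Hs (Om : Set E3) := MeasureTheory.Lp ℝ 2 (mOm Om)

/-- The fractional power (in the spectral sense) with exponent `ρ` of the operator whose
eigenvalues are `lam` and whose orthonormal eigenvectors are `e`. -/
def fracPow {Om : Set E3} (lam : ℕ → ℝ) (e : ℕ → Hs Om) (ρ : ℝ) (v : Hs Om) : Hs Om :=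
  ∑' j, ((lam j) ^ ρ * ⟪v, e j⟫) • e j

/-- Membership in the domain of the fractional power of exponent `ρ`. -/
def inDom {Om : Set E3} (lam : ℕ → ℝ) (e : ℕ → Hs Om) (ρ : ℝ) (v : Hs Om) : Prop :=
  Summable fun j => ((lam j) ^ ρ * ⟪v, e j⟫) ^ 2

/-- Mean value of `v` on `Om`. -/
def meanVal {Om : Set E3} (v : Hs Om) : ℝ := (∫ x, v x ∂(mOm Om)) / (volume Om).toReal

/-- Subdifferential of a convex function `b : ℝ → [0,+∞]`. -/
def subdiff (b : ℝ → ℝ≥0∞) (s : ℝ) : Set ℝ :=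
  {ξ | b s < ⊤ ∧ ∀ t : ℝ, ENNReal.ofReal ((b s).toReal + ξ * (t - s)) ≤ b t}

/-- Square of the graph norm of the domain of a fractional power. -/
def gnormSq {Om : Set E3} (lam : ℕ → ℝ) (e : ℕ → Hs Om) (ρ : ℝ) (v : Hs Om) : ℝ :=
  ‖v‖ ^ 2 + ‖fracPow lam e ρ v‖ ^ 2

/-- Square of the dual norm (the norm of `V_A^{-r}`) of a linear functional. -/
def dualNormSq {Om : Set E3} (lam : ℕ → ℝ) (e : ℕ → Hs Om) (ρ : ℝ)
    (f : Hs Om →ₗ[ℝ] ℝ) : ℝ :=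
  sSup {a : ℝ | ∃ v : Hs Om, inDom lam e ρ v ∧ gnormSq lam e ρ v ≤ 1 ∧ a = (f v) ^ 2}

/-- The inner product of the Hilbert space which is the domain of a fractional power
(e.g.`V_B^σ`). -/
def innerFrac {Om : Set E3} (lam : ℕ → ℝ) (e : ℕ → Hs Om) (ρ : ℝ) (a b : Hs Om) : ℝ :=
  ⟪a, b⟫ + ⟪fracPow lam e ρ a, fracPow lam e ρ b⟫

/-- The structural assumptions: `Om ⊂ ℝ³` is open, connected and bounded; `A` and `B` are
unbounded monotone selfadjoint operators with compact resolvents, described by their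
nondecreasing sequences of eigenvalues `lamA`, `lamB` (tending to `+∞`) and complete
orthonormal systems of eigenvectors `eA`, `eB`; `r, σ > 0`, `τ ∈ [0,1]`; either `λ₁ > 0`
or `0 = λ₁ < λ₂` with `e₁` constant; if `λ₁ = 0` the constants belong to `V_B^σ`. -/
def SettingHyps (Om : Set E3) (lamA lamB : ℕ → ℝ) (eA eB : ℕ → Hs Om)
    (r σ τ : ℝ) : Prop :=
  IsOpen Om ∧ IsConnected Om ∧ Bornology.IsBounded Om ∧
  (∀ j, 0 ≤ lamA j) ∧ (∀ j, 0 ≤ lamB j) ∧ Monotone lamA ∧ Monotone lamB ∧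
  Tendsto lamA atTop atTop ∧ Tendsto lamB atTop atTop ∧
  Orthonormal ℝ eA ∧ Orthonormal ℝ eB ∧
  (Submodule.span ℝ (Set.range eA)).topologicalClosure = ⊤ ∧
  (Submodule.span ℝ (Set.range eB)).topologicalClosure = ⊤ ∧
  0 < r ∧ 0 < σ ∧ τ ∈ Set.Icc (0:ℝ) 1 ∧
  (0 < lamA 0 ∨ (lamA 0 = 0 ∧ 0 < lamA 1 ∧ ∃ c : ℝ, ∀ᵐ x ∂(mOm Om), eA 0 x = c)) ∧
  (lamA 0 = 0 → ∀ c : ℝ, ∃ w : Hs Om, inDom lamB eB σ w ∧ (∀ᵐ x ∂(mOm Om), w x = c))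

/-- The assumptions on the nonlinearity `f = β̂ + π̂` and on the data `u`, `y₀`:
`β̂ : ℝ → [0,+∞]` is convex, l.s.c., with `β̂(0) = 0`; `π̂` is `C¹` with Lipschitz
continuous derivative `π`; the coercivity `liminf_{|s|→∞}(β̂(s)+π̂(s))/s² > 0` holds;
`u ∈ W^{1,1}_loc([0,∞);H)` with primitive representation by `u'` and `∂_t u ∈ L¹(0,∞;H)`;
`y₀ ∈ V_B^σ` with `β̂(y₀) ∈ L¹(Om)`; and if `λ₁ = 0` the mean of `y₀` lies in the
interior of `D(β)`. -/
def DataHyps (Om : Set E3) (lamA lamB : ℕ → ℝ) (eB : ℕ → Hs Om) (σ : ℝ)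
    (betah : ℝ → ℝ≥0∞) (pih piF : ℝ → ℝ) (Lpi : ℝ≥0)
    (u u' : ℝ → Hs Om) (y0 : Hs Om) : Prop :=
  (∀ a b t : ℝ, 0 ≤ t → t ≤ 1 →
    betah (t * a + (1 - t) * b) ≤ ENNReal.ofReal t * betah a + ENNReal.ofReal (1 - t) * betah b) ∧
  LowerSemicontinuous betah ∧ betah 0 = 0 ∧
  (∀ s, HasDerivAt pih (piF s) s) ∧ LipschitzWith Lpi piF ∧
  (∃ α : ℝ, 0 < α ∧ ∀ᶠ s : ℝ in Filter.comap (|·|) atTop,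
    ENNReal.ofReal (α * s ^ 2 - pih s) ≤ betah s) ∧
  IntegrableOn u' (Set.Ioi (0:ℝ)) ∧
  (∀ t : ℝ, 0 ≤ t → u t = u 0 + ∫ s in (0:ℝ)..t, u' s) ∧
  inDom lamB eB σ y0 ∧ (∫⁻ x, betah (y0 x) ∂(mOm Om)) < ⊤ ∧
  (lamA 0 = 0 → meanVal y0 ∈ interior {s : ℝ | (subdiff betah s).Nonempty})

/-- The notion of solution `(y, μ)` of the weak formulation of the fractional
Cahn--Hilliard system on the half line `t ≥ 0`.  Here `dy t ∈ V_A^{-r}` represents the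
time derivative `∂_t y(t)` (acting on test functions, and linked to `y` by the integral
identity `(y(t),v) = (y(0),v) + ∫_0^t ⟨∂_t y(s),v⟩ ds`), while `z` represents
`τ ∂_t y ∈ L²(0,T;H)`.  The requirements are the regularity
`y ∈ L^∞(0,T;V_B^σ)`, `∂_t y ∈ L²(0,T;V_A^{-r})`, `τ ∂_t y ∈ L²(0,T;H)`,
`μ ∈ L²(0,T;V_A^r)`, `β̂(y) ∈ L¹(Om×(0,T))` for every `T > 0`, the two variational
equations/inequalities for a.a. `t`, and the initial condition `y(0) = y₀`. -/
def IsSolution (Om : Set E3) (lamA lamB : ℕ → ℝ) (eA eB : ℕ → Hs Om) (r σ τ : ℝ)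
    (betah : ℝ → ℝ≥0∞) (piF : ℝ → ℝ) (u : ℝ → Hs Om) (y0 : Hs Om)
    (y μ : ℝ → Hs Om) (dy : ℝ → Hs Om →ₗ[ℝ] ℝ) (z : ℝ → Hs Om) : Prop :=
  AEStronglyMeasurable y (volume.restrict (Set.Ioi (0:ℝ))) ∧
  (∀ᵐ t ∂(volume.restrict (Set.Ioi (0:ℝ))), inDom lamB eB σ (y t)) ∧
  (∀ T : ℝ, 0 < T → ∃ C : ℝ,
    ∀ᵐ t ∂(volume.restrict (Set.Ioc (0:ℝ) T)), gnormSq lamB eB σ (y t) ≤ C) ∧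
  (∀ v : Hs Om, inDom lamA eA r v → ∀ T : ℝ, 0 < T →
    IntegrableOn (fun s => dy s v) (Set.Ioc (0:ℝ) T)) ∧
  (∀ v : Hs Om, inDom lamA eA r v → ∀ t : ℝ, 0 ≤ t →
    ⟪y t, v⟫ = ⟪y 0, v⟫ + ∫ s in (0:ℝ)..t, dy s v) ∧
  (∀ T : ℝ, 0 < T → IntegrableOn (fun t => dualNormSq lamA eA r (dy t)) (Set.Ioc (0:ℝ) T)) ∧
  AEStronglyMeasurable z (volume.restrict (Set.Ioi (0:ℝ))) ∧
  (∀ᵐ t ∂(volume.restrict (Set.Ioi (0:ℝ))), ∀ v : Hs Om, inDom lamA eA r v →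
    ⟪z t, v⟫ = τ * dy t v) ∧
  (∀ T : ℝ, 0 < T → IntegrableOn (fun t => ‖z t‖ ^ 2) (Set.Ioc (0:ℝ) T)) ∧
  AEStronglyMeasurable μ (volume.restrict (Set.Ioi (0:ℝ))) ∧
  (∀ᵐ t ∂(volume.restrict (Set.Ioi (0:ℝ))), inDom lamA eA r (μ t)) ∧
  (∀ T : ℝ, 0 < T → IntegrableOn (fun t => gnormSq lamA eA r (μ t)) (Set.Ioc (0:ℝ) T)) ∧
  (∀ T : ℝ, 0 < T → (∫⁻ t in Set.Ioc (0:ℝ) T, ∫⁻ x, betah (y t x) ∂(mOm Om)) < ⊤) ∧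
  (∀ᵐ t ∂(volume.restrict (Set.Ioi (0:ℝ))), ∀ v : Hs Om, inDom lamA eA r v →
    dy t v + ⟪fracPow lamA eA r (μ t), fracPow lamA eA r v⟫ = 0) ∧
  (∀ᵐ t ∂(volume.restrict (Set.Ioi (0:ℝ))), ∀ v : Hs Om,
    inDom lamB eB σ v → (∫⁻ x, betah (v x) ∂(mOm Om)) < ⊤ →
    ⟪z t, y t - v⟫
      + ⟪fracPow lamB eB σ (y t), fracPow lamB eB σ (y t) - fracPow lamB eB σ v⟫
      + (∫⁻ x, betah (y t x) ∂(mOm Om)).toReal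
      + ∫ x, (piF (y t x) - u t x) * (y t x - v x) ∂(mOm Om)
      ≤ ⟪μ t, y t - v⟫ + (∫⁻ x, betah (v x) ∂(mOm Om)).toReal) ∧
  y 0 = y0

/-- The ω-limit set of the trajectory `y`, in the weak topology of `V_B^σ`. -/
def omegaLimit {Om : Set E3} (lamB : ℕ → ℝ) (eB : ℕ → Hs Om) (σ : ℝ)
    (y : ℝ → Hs Om) : Set (Hs Om) :=
  {w | inDom lamB eB σ w ∧ ∃ tn : ℕ → ℝ, StrictMono tn ∧ (∀ n, 0 ≤ tn n) ∧
    Tendsto tn atTop atTop ∧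
    ∀ φ : Hs Om, inDom lamB eB σ φ →
      Tendsto (fun n => innerFrac lamB eB σ (y (tn n)) φ) atTop
        (nhds (innerFrac lamB eB σ w φ))}

section Spectral

variable {Om : Set E3} {lam : ℕ → ℝ} {ρ : ℝ} (b : HilbertBasis ℕ ℝ (Hs Om))

lemma inDom.hasSum_fracPow {v : Hs Om} (hv : inDom lam b ρ v) :
    HasSum (fun j => ((lam j) ^ ρ * ⟪v, b j⟫) • b j) (fracPow lam b ρ v) := by
  have hf : Memℓp (fun j => (lam j) ^ ρ * ⟪v, b j⟫) 2 := by
    apply memℓp_gen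
    simpa [inDom, mul_pow] using hv
  exact (b.hasSum_repr_symm ⟨_, hf⟩).summable.hasSum

lemma inner_fracPow_basis {v : Hs Om} (hv : inDom lam b ρ v) (j : ℕ) :
    ⟪fracPow lam b ρ v, b j⟫ = (lam j) ^ ρ * ⟪v, b j⟫ := by
  have h := (hv.hasSum_fracPow b).mapL (innerSL ℝ (b j))
  have h2 := hasSum_single (f := fun i => (innerSL ℝ (b j)) (((lam i) ^ ρ * ⟪v, b i⟫) • b i)) j
    (by
      intro i hi
      simp [orthonormal_iff_ite.1 b.orthonormal, hi.symm])
  rw [real_inner_comm]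
  have := h.unique h2
  simpa [inner_smul_right, b.orthonormal.1 j] using this

lemma hasSum_inner_basis_sq (v : Hs Om) : HasSum (fun j => ⟪v, b j⟫ ^ 2) (‖v‖ ^ 2) := by
  have h := b.hasSum_inner_mul_inner v v
  rw [real_inner_self_eq_norm_sq] at h
  simpa only [real_inner_comm v, ← sq] using h

lemma hasSum_norm_fracPow_sq {v : Hs Om} (hv : inDom lam b ρ v) :
    HasSum (fun j => ((lam j) ^ ρ * ⟪v, b j⟫) ^ 2) (‖fracPow lam b ρ v‖ ^ 2) := by
  simpa only [inner_fracPow_basis b hv] using hasSum_inner_basis_sq b (fracPow lam b ρ v)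

lemma eq_of_inner_basis_eq {v w : Hs Om} (h : ∀ j, ⟪v, b j⟫ = ⟪w, b j⟫) : v = w := by
  have := hasSum_inner_basis_sq b (v - w)
  simp only [inner_sub_left, h, sub_self] at this
  have h0 : ‖v - w‖ ^ 2 = 0 := this.unique (by simp)
  simpa [sub_eq_zero] using h0

lemma inDom.sub {v w : Hs Om} (hv : inDom lam b ρ v) (hw : inDom lam b ρ w) :
    inDom lam b ρ (v - w) := by
  unfold inDom at *
  refine Summable.of_nonneg_of_le (fun _ => sq_nonneg _) (fun j => ?_)
    ((hv.mul_left 2).add (hw.mul_left 2))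
  rw [inner_sub_left]
  nlinarith [sq_nonneg ((lam j) ^ ρ * ⟪v, b j⟫ + (lam j) ^ ρ * ⟪w, b j⟫)]

lemma fracPow_sub {v w : Hs Om} (hv : inDom lam b ρ v) (hw : inDom lam b ρ w) :
    fracPow lam b ρ (v - w) = fracPow lam b ρ v - fracPow lam b ρ w := by
  apply eq_of_inner_basis_eq b
  intro j
  rw [inner_fracPow_basis b (hv.sub b hw), inner_sub_left, inner_sub_left,
    inner_fracPow_basis b hv, inner_fracPow_basis b hw]
  ring

lemma inDom_of_span {v : Hs Om} (hv : v ∈ Submodule.span ℝ (Set.range b)) :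
    inDom lam b ρ v := by
  unfold inDom
  induction hv using Submodule.span_induction with
  | mem x hx =>
    obtain ⟨i, rfl⟩ := hx
    refine (hasSum_single i ?_).summable
    intro j hj
    simp [orthonormal_iff_ite.1 b.orthonormal, hj.symm]
  | zero => simp [summable_zero]
  | add x y _ _ hx hy =>
    refine Summable.of_nonneg_of_le (fun _ => sq_nonneg _) (fun j => ?_)
      ((hx.mul_left 2).add (hy.mul_left 2))
    rw [inner_add_left]
    nlinarith [sq_nonneg ((lam j) ^ ρ * ⟪x, b j⟫ - (lam j) ^ ρ * ⟪y, b j⟫)]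
  | smul a x _ hx =>
    refine (hx.mul_left (a ^ 2)).congr (fun j => ?_)
    rw [real_inner_smul_left]
    ring

lemma inDom_basis (j : ℕ) : inDom lam b ρ (b j) :=
  inDom_of_span b (Submodule.subset_span ⟨j, rfl⟩)

lemma dense_span_basis : Dense (Submodule.span ℝ (Set.range b) : Set (Hs Om)) := by
  have := b.dense_span
  rwa [← Submodule.dense_iff_topologicalClosure_eq_top] at this

lemma dense_inDom : Dense {v : Hs Om | inDom lam b ρ v} :=
  (dense_span_basis b).mono fun _ hv => inDom_of_span b hv

/-- The part of `v` beyond the first `N` modes is controlled by the fractional power. -/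
lemma norm_sq_le_sum_add_fracPow (hpos : ∀ j, 0 ≤ lam j) (hmono : Monotone lam) (hρ : 0 < ρ)
    {v : Hs Om} (hv : inDom lam b ρ v) (N : ℕ) (hN : 0 < lam N) :
    ‖v‖ ^ 2 ≤ ∑ j ∈ Finset.range N, ⟪v, b j⟫ ^ 2
      + ((lam N ^ ρ) ^ 2)⁻¹ * ‖fracPow lam b ρ v‖ ^ 2 := by
  have h1 := hasSum_inner_basis_sq b v
  have h2 := (hasSum_norm_fracPow_sq b hv).mul_left ((lam N ^ ρ) ^ 2)⁻¹
  have h3 : HasSum (fun j => if j ∈ Finset.range N then ⟪v, b j⟫ ^ 2 else 0)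
      (∑ j ∈ Finset.range N, ⟪v, b j⟫ ^ 2) := by
    have := hasSum_sum_of_ne_finset_zero (L := .unconditional ℕ) (s := Finset.range N)
      (f := fun j => if j ∈ Finset.range N then ⟪v, b j⟫ ^ 2 else 0)
      (fun j hj => if_neg hj)
    rwa [Finset.sum_congr rfl (fun j hj => if_pos hj)] at this
  refine hasSum_le (fun j => ?_) h1 (h3.add h2)
  have hp : 0 < lam N ^ ρ := Real.rpow_pos_of_pos hN ρ
  by_cases hj : j ∈ Finset.range N
  · rw [if_pos hj]
    have : 0 ≤ ((lam N ^ ρ) ^ 2)⁻¹ * ((lam j) ^ ρ * ⟪v, b j⟫) ^ 2 := by positivity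
    linarith
  · rw [if_neg hj, zero_add]
    have hNj : N ≤ j := by simpa using hj
    have hle : lam N ^ ρ ≤ lam j ^ ρ :=
      Real.rpow_le_rpow (hpos N) (hmono hNj) hρ.le
    rw [mul_pow, ← mul_assoc]
    refine le_mul_of_one_le_left (sq_nonneg _) ?_
    rw [inv_mul_eq_div, one_le_div (by positivity)]
    gcongr

/-- Closedness of balls of the domain of the fractional power under convergence of
coefficients. -/
lemma inDom_of_tendsto {v : ℕ → Hs Om} {w : Hs Om} {C : ℝ}
    (hv : ∀ n, inDom lam b ρ (v n)) (hC : ∀ n, gnormSq lam b ρ (v n) ≤ C)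
    (hlim : ∀ j, Tendsto (fun n => ⟪v n, b j⟫) atTop (𝓝 ⟪w, b j⟫)) :
    inDom lam b ρ w ∧ gnormSq lam b ρ w ≤ C := by
  have hfin : ∀ s : Finset ℕ,
      ∑ j ∈ s, (⟪w, b j⟫ ^ 2 + ((lam j) ^ ρ * ⟪w, b j⟫) ^ 2) ≤ C := by
    intro s
    have ht : Tendsto (fun n => ∑ j ∈ s, (⟪v n, b j⟫ ^ 2 + ((lam j) ^ ρ * ⟪v n, b j⟫) ^ 2)) atTop
        (𝓝 (∑ j ∈ s, (⟪w, b j⟫ ^ 2 + ((lam j) ^ ρ * ⟪w, b j⟫) ^ 2))) := by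
      refine tendsto_finsetSum _ fun j _ => ?_
      exact ((hlim j).pow 2).add (((hlim j).const_mul _).pow 2)
    refine le_of_tendsto' ht fun n => ?_
    refine le_trans ?_ (hC n)
    exact sum_le_hasSum s (fun j _ => by positivity)
      ((hasSum_inner_basis_sq b (v n)).add (hasSum_norm_fracPow_sq b (hv n)))
  have hdom : inDom lam b ρ w := by
    unfold inDom
    refine summable_of_sum_le (c := C) (fun j => sq_nonneg _) fun s => ?_
    refine le_trans (Finset.sum_le_sum fun j _ => ?_) (hfin s)
    nlinarith [sq_nonneg ⟪w, b j⟫]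
  refine ⟨hdom, ?_⟩
  exact hasSum_le_of_sum_le ((hasSum_inner_basis_sq b w).add (hasSum_norm_fracPow_sq b hdom)) hfin

/-- Coefficientwise convergence and boundedness in the graph norm imply strong convergence. -/
lemma tendsto_of_gnormSq_le (hpos : ∀ j, 0 ≤ lam j) (hmono : Monotone lam)
    (hlam : Tendsto lam atTop atTop) (hρ : 0 < ρ)
    {v : ℕ → Hs Om} {w : Hs Om} {C : ℝ}
    (hv : ∀ n, inDom lam b ρ (v n)) (hC : ∀ n, gnormSq lam b ρ (v n) ≤ C)
    (hlim : ∀ j, Tendsto (fun n => ⟪v n, b j⟫) atTop (𝓝 ⟪w, b j⟫)) :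
    Tendsto v atTop (𝓝 w) := by
  obtain ⟨hw, hwC⟩ := inDom_of_tendsto b hv hC hlim
  have hB : ∀ n, ‖fracPow lam b ρ (v n - w)‖ ^ 2 ≤ 4 * C := by
    intro n
    rw [fracPow_sub b (hv n) hw]
    have h1 : ‖fracPow lam b ρ (v n)‖ ^ 2 ≤ C := by
      have := hC n; unfold gnormSq at this; nlinarith [sq_nonneg ‖v n‖]
    have h2 : ‖fracPow lam b ρ w‖ ^ 2 ≤ C := by
      unfold gnormSq at hwC; nlinarith [sq_nonneg ‖w‖]
    have h3 := norm_sub_le (fracPow lam b ρ (v n)) (fracPow lam b ρ w)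
    have h4 := norm_nonneg (fracPow lam b ρ (v n) - fracPow lam b ρ w)
    nlinarith [sq_nonneg (‖fracPow lam b ρ (v n)‖ - ‖fracPow lam b ρ w‖)]
  have hC0 : 0 ≤ C := le_trans (by unfold gnormSq; positivity) hwC
  have hpowtop : Tendsto (fun N => (lam N ^ ρ) ^ 2) atTop atTop :=
    (tendsto_pow_atTop two_ne_zero).comp ((_root_.tendsto_rpow_atTop hρ).comp hlam)
  have hsq : Tendsto (fun n => ‖v n - w‖ ^ 2) atTop (𝓝 0) := by
    rw [Metric.tendsto_atTop]
    intro ε hε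
    have hsmall : Tendsto (fun N => ((lam N ^ ρ) ^ 2)⁻¹ * (4 * C)) atTop (𝓝 0) := by
      simpa using (hpowtop.inv_tendsto_atTop).mul_const (4 * C)
    obtain ⟨N, hN1, hN2⟩ := ((hsmall.eventually_lt_const (half_pos hε)).and
      (hlam.eventually_gt_atTop 0)).exists
    have hfin : Tendsto (fun n => ∑ j ∈ Finset.range N, ⟪v n - w, b j⟫ ^ 2) atTop (𝓝 0) := by
      have : Tendsto (fun n => ∑ j ∈ Finset.range N, ⟪v n - w, b j⟫ ^ 2) atTop
          (𝓝 (∑ j ∈ Finset.range N, (⟪w, b j⟫ - ⟪w, b j⟫) ^ 2)) := by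
        refine tendsto_finsetSum _ fun j _ => ?_
        simp only [inner_sub_left]
        exact ((hlim j).sub_const _).pow 2
      simpa using this
    obtain ⟨n0, hn0⟩ := eventually_atTop.1 (hfin.eventually_lt_const (half_pos hε))
    refine ⟨n0, fun n hn => ?_⟩
    have h1 := norm_sq_le_sum_add_fracPow b hpos hmono hρ ((hv n).sub b hw) N hN2
    have h2 := hn0 n hn
    have h3 : ((lam N ^ ρ) ^ 2)⁻¹ * ‖fracPow lam b ρ (v n - w)‖ ^ 2
        ≤ ((lam N ^ ρ) ^ 2)⁻¹ * (4 * C) :=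
      mul_le_mul_of_nonneg_left (hB n) (by positivity)
    rw [Real.dist_eq, sub_zero, abs_of_nonneg (sq_nonneg _)]
    linarith
  rw [tendsto_iff_norm_sub_tendsto_zero]
  have := hsq.sqrt
  simpa [Real.sqrt_sq] using this

end Spectral

section WeakConvergence

variable {X : Type*} [NormedAddCommGroup X] [InnerProductSpace ℝ X]

/-- A bounded sequence that converges weakly against a dense set converges weakly. -/
lemma tendsto_inner_of_dense {D : Set X} (hD : Dense D) {x : ℕ → X} {C : ℝ}
    (hx : ∀ n, ‖x n‖ ≤ C) (h : ∀ d ∈ D, Tendsto (fun n => ⟪x n, d⟫) atTop (𝓝 0)) (k : X) :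
    Tendsto (fun n => ⟪x n, k⟫) atTop (𝓝 0) := by
  have hC : 0 ≤ C := (norm_nonneg _).trans (hx 0)
  rw [Metric.tendsto_atTop]
  intro ε hε
  obtain ⟨d, hd, hkd⟩ := hD.exists_dist_lt k (ε := ε / (2 * (C + 1))) (by positivity)
  obtain ⟨n0, hn0⟩ := Metric.tendsto_atTop.1 (h d hd) (ε / 2) (half_pos hε)
  refine ⟨n0, fun n hn => ?_⟩
  have h1 := hn0 n hn
  rw [Real.dist_eq, sub_zero] at h1 ⊢
  have h2 : ⟪x n, k⟫ = ⟪x n, d⟫ + ⟪x n, k - d⟫ := by rw [inner_sub_right]; ring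
  have h3 : |⟪x n, k - d⟫| ≤ (C + 1) * (ε / (2 * (C + 1))) := by
    refine (abs_real_inner_le_norm _ _).trans ?_
    rw [dist_eq_norm] at hkd
    exact mul_le_mul ((hx n).trans (by linarith)) hkd.le (norm_nonneg _) (by positivity)
  have h4 : (C + 1) * (ε / (2 * (C + 1))) = ε / 2 := by field_simp
  rw [h2]
  calc _ ≤ |⟪x n, d⟫| + |⟪x n, k - d⟫| := abs_add_le _ _
    _ < ε := by linarith

end WeakConvergence

section TimeAnalysis

lemma intervalIntegrable_of_locallyIntegrable {X : Type*} [NormedAddCommGroup X] {f : ℝ → X}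
    (hf : LocallyIntegrable f volume) (a b : ℝ) : IntervalIntegrable f volume a b :=
  intervalIntegrable_iff.mpr <|
    (hf.integrableOn_isCompact isCompact_uIcc).mono_set uIoc_subset_uIcc

lemma tendsto_backward_slope {X : Type*} [NormedAddCommGroup X] [NormedSpace ℝ X] {f : ℝ → X}
    {f' : X} {x : ℝ} (hf : HasDerivAt f f' x) {h : ℕ → ℝ} (hpos : ∀ n, 0 < h n)
    (h0 : Tendsto h atTop (𝓝 0)) :
    Tendsto (fun n => (h n)⁻¹ • (f x - f (x - h n))) atTop (𝓝 f') := by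
  have h1 := hasDerivAt_iff_tendsto_slope_zero.1 hf
  have h2 : Tendsto (fun n => -h n) atTop (𝓝[≠] 0) := by
    refine tendsto_nhdsWithin_iff.2 ⟨by simpa using h0.neg, Eventually.of_forall fun n => ?_⟩
    simpa using (hpos n).ne'
  refine (h1.comp h2).congr fun n => ?_
  simp only [Function.comp, inv_neg, neg_smul, ← smul_neg, neg_sub, ← sub_eq_add_neg]

lemma integral_shift_sub {φ : ℝ → ℝ} (hφ : ∀ p q, IntervalIntegrable φ volume p q) (a b h : ℝ) :
    ∫ t in a..b, (φ t - φ (t - h))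
      = ((∫ t in (0:ℝ)..b, φ t) - ∫ t in (0:ℝ)..(b - h), φ t)
        - ((∫ t in (0:ℝ)..a, φ t) - ∫ t in (0:ℝ)..(a - h), φ t) := by
  have hsh : IntervalIntegrable (fun t => φ (t - h)) volume a b := by
    simpa using (hφ (a - h) (b - h)).comp_sub_right h
  rw [intervalIntegral.integral_sub (hφ _ _) hsh, intervalIntegral.integral_comp_sub_right,
    ← intervalIntegral.integral_interval_sub_left (hφ 0 b) (hφ 0 a),
    ← intervalIntegral.integral_interval_sub_left (hφ 0 (b - h)) (hφ 0 (a - h))]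
  ring

/-- A bound on the increments of `E` which is asymptotically sharp for small time steps
integrates to an energy inequality. -/
lemma energy_inequality_of_increments {X : Type*} [NormedAddCommGroup X] [InnerProductSpace ℝ X]
    [CompleteSpace X] {G : ℝ → X} {E k : ℝ → ℝ} {T M C : ℝ} {P : ℝ → Prop}
    (hG : LocallyIntegrable G) (hg : LocallyIntegrable fun t => ‖G t‖ ^ 2)
    (hE : LocallyIntegrable E) (hk : LocallyIntegrable k)
    (hP : ∀ᵐ t, t ∈ Ioo 0 T → P t)
    (h : ∀ s t, 0 < s → s < t → t < T → P s → P t →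
      E t - E s ≤ -(∫ p in s..t, ⟪G t, G p⟫) + M * (∫ p in s..t, k p)
        + C * ((t - s) * ∫ p in s..t, ‖G p‖ ^ 2)) :
    ∀ᵐ a : ℝ, ∀ᵐ b : ℝ, 0 < a → a < b → b < T →
      E b - E a + ∫ p in a..b, ‖G p‖ ^ 2 ≤ M * ∫ p in a..b, k p := by
  set g : ℝ → ℝ := fun t => ‖G t‖ ^ 2 with hgdef
  have iG := intervalIntegrable_of_locallyIntegrable hG
  have ig := intervalIntegrable_of_locallyIntegrable hg
  have iE := intervalIntegrable_of_locallyIntegrable hE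
  have ik := intervalIntegrable_of_locallyIntegrable hk
  set Γ : ℝ → ℝ := fun t => ∫ p in (0:ℝ)..t, g p with hΓ
  set κ : ℝ → ℝ := fun t => ∫ p in (0:ℝ)..t, k p with hκ
  have cΓ : Continuous Γ := intervalIntegral.continuous_primitive ig 0
  have cκ : Continuous κ := intervalIntegral.continuous_primitive ik 0
  have dΓ : ∀ s t, ∫ p in s..t, g p = Γ t - Γ s := fun s t =>
    (intervalIntegral.integral_interval_sub_left (ig 0 t) (ig 0 s)).symm
  have dκ : ∀ s t, ∫ p in s..t, k p = κ t - κ s := fun s t =>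
    (intervalIntegral.integral_interval_sub_left (ik 0 t) (ik 0 s)).symm
  set Ψ : ℝ → ℝ := fun t => -E t + (1 / 2 * Γ t + M * κ t) with hΨ
  have cc : Continuous fun t => 1 / 2 * Γ t + M * κ t := by fun_prop
  have iΨ : ∀ p q, IntervalIntegrable Ψ volume p q := fun p q =>
    (iE p q).neg.add (cc.intervalIntegrable p q)
  have derΨ : ∀ x, HasDerivAt (fun x => ∫ t in (0:ℝ)..x, E t) (E x) x →
      HasDerivAt (fun x => ∫ t in (0:ℝ)..x, Ψ t) (Ψ x) x := by
    intro x hx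
    have h1 := hx.neg.add (cc.integral_hasStrictDerivAt 0 x).hasDerivAt
    refine h1.congr_of_eventuallyEq (Eventually.of_forall fun y => ?_)
    simp only [hΨ, Pi.add_apply, Pi.neg_apply]
    exact (intervalIntegral.integral_add (iE 0 y).neg (cc.intervalIntegrable _ _)).trans
      (congrArg (· + _) intervalIntegral.integral_neg)
  have leb := _root_.LocallyIntegrable.ae_hasDerivAt_integral hE
  filter_upwards [leb] with a ha
  filter_upwards [leb] with b hb
  intro ha0 hab hbT
  replace ha := derΨ a (ha 0)
  replace hb := derΨ b (hb 0)
  set d : ℕ → ℝ := fun n => a / (n + 2) with hd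
  have dpos : ∀ n, 0 < d n := fun n => by positivity
  have dlt : ∀ n, d n < a := fun n => by
    rw [hd]; simp only
    rw [div_lt_iff₀ (by positivity)]
    nlinarith [Nat.cast_nonneg (α := ℝ) n]
  have dlim : Tendsto d atTop (𝓝 0) :=
    Tendsto.div_atTop tendsto_const_nhds
      (tendsto_atTop_add_const_right _ _ tendsto_natCast_atTop_atTop)
  set R : ℕ → ℝ → ℝ := fun n t =>
    (d n)⁻¹ * (Ψ t - Ψ (t - d n)) + 1 / 2 * g t + C * (Γ t - Γ (t - d n)) with hR
  set F : ℕ → ℝ → ℝ := fun n t =>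
    ⟪G t, (d n)⁻¹ • ∫ p in (t - d n)..t, G p⟫ + 1 / 2 * ((d n)⁻¹ * (Γ t - Γ (t - d n)))
      + 1 / 2 * g t with hF
  have innerInt : ∀ s t x, ∫ p in s..t, ⟪x, G p⟫ = ⟪x, ∫ p in s..t, G p⟫ := fun s t x =>
    (innerSL ℝ x).intervalIntegral_comp_comm (iG s t)
  have iinner : ∀ s t x, IntervalIntegrable (fun p => ⟪x, G p⟫) volume s t := fun s t x =>
    ⟨(innerSL ℝ x).integrable_comp (iG s t).1, (innerSL ℝ x).integrable_comp (iG s t).2⟩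
  have F0 : ∀ n t, 0 ≤ F n t := by
    intro n t
    have hle : ∫ p in (t - d n)..t, -⟪G t, G p⟫ ≤ ∫ p in (t - d n)..t, (1 / 2 * g p + 1 / 2 * g t) := by
      refine intervalIntegral.integral_mono_on (by linarith [dpos n]) (iinner _ _ _).neg
        (((ig _ _).const_mul _).add intervalIntegrable_const) fun p _ => ?_
      have := abs_le.1 (abs_real_inner_le_norm (G t) (G p))
      simp only [hgdef]
      nlinarith [sq_nonneg (‖G t‖ - ‖G p‖)]
    rw [intervalIntegral.integral_neg, innerInt,
      intervalIntegral.integral_add ((ig _ _).const_mul _) intervalIntegrable_const,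
      intervalIntegral.integral_const_mul, dΓ, intervalIntegral.integral_const,
      _root_.sub_sub_cancel, smul_eq_mul] at hle
    simp only [hF, inner_smul_right]
    have := mul_le_mul_of_nonneg_left hle (inv_pos.2 (dpos n)).le
    have e : (d n)⁻¹ * (1 / 2 * (Γ t - Γ (t - d n)) + d n * (1 / 2 * g t))
        = 1 / 2 * ((d n)⁻¹ * (Γ t - Γ (t - d n))) + 1 / 2 * g t := by
      field_simp [(dpos n).ne']
    rw [e] at this
    linarith
  have FR : ∀ n, ∀ᵐ t ∂(volume.restrict (Ioc a b)), F n t ≤ R n t := by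
    intro n
    have hP' : ∀ᵐ t, t - d n ∈ Ioo 0 T → P (t - d n) :=
      (measurePreserving_sub_right volume (d n)).quasiMeasurePreserving.ae hP
    rw [ae_restrict_iff' measurableSet_Ioc]
    filter_upwards [hP, hP'] with t h1 h2 ht
    have hd1 := dpos n
    have hd2 := dlt n
    have key := h (t - d n) t (by linarith [ht.1]) (by linarith) (by linarith [ht.2])
      (h2 ⟨by linarith [ht.1], by linarith [ht.2]⟩) (h1 ⟨by linarith [ht.1], by linarith [ht.2]⟩)
    rw [innerInt, dΓ, dκ, _root_.sub_sub_cancel] at key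
    have key2 := mul_le_mul_of_nonneg_left key (inv_pos.2 hd1).le
    have e : (d n)⁻¹ * (C * (d n * (Γ t - Γ (t - d n)))) = C * (Γ t - Γ (t - d n)) := by
      field_simp [hd1.ne']
    simp only [hF, hR, hΨ, inner_smul_right]
    rw [mul_add, mul_add, e] at key2
    linarith
  have Flim : ∀ᵐ t, Tendsto (fun n => F n t) atTop (𝓝 (2 * g t)) := by
    filter_upwards [_root_.LocallyIntegrable.ae_hasDerivAt_integral hG, _root_.LocallyIntegrable.ae_hasDerivAt_integral hg] with t h1 h2
    have t1 := tendsto_backward_slope (h1 0) dpos dlim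
    have t2 := tendsto_backward_slope (h2 0) dpos dlim
    have t3 : Tendsto (fun n => ⟪G t, (d n)⁻¹ • ∫ p in (t - d n)..t, G p⟫) atTop (𝓝 ⟪G t, G t⟫) := by
      refine Tendsto.inner tendsto_const_nhds (t1.congr fun n => ?_)
      rw [intervalIntegral.integral_interval_sub_left (iG _ _) (iG _ _)]
    have t4 := (t3.add (t2.const_mul (1 / 2))).add_const (1 / 2 * g t)
    have e : ⟪G t, G t⟫ + 1 / 2 * g t + 1 / 2 * g t = 2 * g t := by
      rw [real_inner_self_eq_norm_sq]; simp only [hgdef]; ring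
    rw [e] at t4
    exact t4
  have iΨs : ∀ n, IntervalIntegrable (fun t => Ψ t - Ψ (t - d n)) volume a b := fun n =>
    (iΨ a b).sub (by simpa using (iΨ (a - d n) (b - d n)).comp_sub_right (d n))
  have iΓs : ∀ n, IntervalIntegrable (fun t => Γ t - Γ (t - d n)) volume a b := fun n =>
    Continuous.intervalIntegrable (by fun_prop) _ _
  have iR : ∀ n, IntervalIntegrable (R n) volume a b := fun n =>
    (((iΨs n).const_mul _).add ((ig a b).const_mul _)).add ((iΓs n).const_mul _)
  have intR : ∀ n, ∫ t in a..b, R n t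
      = (d n)⁻¹ * (((∫ t in (0:ℝ)..b, Ψ t) - ∫ t in (0:ℝ)..(b - d n), Ψ t)
        - ((∫ t in (0:ℝ)..a, Ψ t) - ∫ t in (0:ℝ)..(a - d n), Ψ t))
        + 1 / 2 * (Γ b - Γ a)
        + C * (((∫ t in (0:ℝ)..b, Γ t) - ∫ t in (0:ℝ)..(b - d n), Γ t)
        - ((∫ t in (0:ℝ)..a, Γ t) - ∫ t in (0:ℝ)..(a - d n), Γ t)) := by
    intro n
    simp only [hR]
    rw [intervalIntegral.integral_add (((iΨs n).const_mul _).add ((ig a b).const_mul _))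
        ((iΓs n).const_mul _),
      intervalIntegral.integral_add ((iΨs n).const_mul _) ((ig a b).const_mul _),
      intervalIntegral.integral_const_mul, intervalIntegral.integral_const_mul,
      intervalIntegral.integral_const_mul, integral_shift_sub iΨ, dΓ,
      integral_shift_sub fun p q => cΓ.intervalIntegrable p q]
  set Q : ℝ := (Ψ b - Ψ a) + 1 / 2 * (Γ b - Γ a) with hQ
  have Rlim : Tendsto (fun n => ∫ t in a..b, R n t) atTop (𝓝 Q) := by
    have l1 := (tendsto_backward_slope hb dpos dlim).sub (tendsto_backward_slope ha dpos dlim)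
    have cI : Continuous fun x => ∫ t in (0:ℝ)..x, Γ t :=
      intervalIntegral.continuous_primitive (fun p q => cΓ.intervalIntegrable p q) 0
    have sh : ∀ x : ℝ, Tendsto (fun n => (∫ t in (0:ℝ)..x, Γ t) - ∫ t in (0:ℝ)..(x - d n), Γ t)
        atTop (𝓝 0) := by
      intro x
      have : Tendsto (fun n => x - d n) atTop (𝓝 x) := by simpa using dlim.const_sub x
      simpa using ((cI.tendsto x).comp this).const_sub (∫ t in (0:ℝ)..x, Γ t)
    have l2 := (l1.add_const (1 / 2 * (Γ b - Γ a))).add (((sh b).sub (sh a)).const_mul C)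
    rw [sub_zero, mul_zero, add_zero] at l2
    refine l2.congr fun n => ?_
    rw [intR, smul_eq_mul, smul_eq_mul]
    ring
  have Rnn : ∀ n, 0 ≤ᵐ[volume.restrict (Ioc a b)] R n := fun n => by
    filter_upwards [FR n] with t ht using (F0 n t).trans ht
  have fatou : ∫⁻ t in Ioc a b, ENNReal.ofReal (2 * g t) ≤ ENNReal.ofReal Q := by
    calc ∫⁻ t in Ioc a b, ENNReal.ofReal (2 * g t)
        ≤ ∫⁻ t in Ioc a b, liminf (fun n => ENNReal.ofReal (R n t)) atTop := by
          refine lintegral_mono_ae ?_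
          filter_upwards [ae_all_iff.2 FR, ae_restrict_of_ae Flim] with t h1 h2
          rw [← (ENNReal.tendsto_ofReal h2).liminf_eq]
          exact liminf_le_liminf (Eventually.of_forall fun n => ENNReal.ofReal_le_ofReal (h1 n))
      _ ≤ liminf (fun n => ∫⁻ t in Ioc a b, ENNReal.ofReal (R n t)) atTop :=
          lintegral_liminf_le' fun n => (iR n).1.aestronglyMeasurable.aemeasurable.ennreal_ofReal
      _ = ENNReal.ofReal Q := by
          refine Tendsto.liminf_eq ?_
          refine (ENNReal.tendsto_ofReal Rlim).congr fun n => ?_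
          rw [intervalIntegral.integral_of_le hab.le,
            ofReal_integral_eq_lintegral_ofReal (iR n).1 (Rnn n)]
  have Q0 : 0 ≤ Q := by
    refine ge_of_tendsto' Rlim fun n => ?_
    rw [intervalIntegral.integral_of_le hab.le]
    exact integral_nonneg_of_ae (Rnn n)
  rw [← ofReal_integral_eq_lintegral_ofReal ((ig a b).1.const_mul 2)
    (Eventually.of_forall fun t => by simp only [hgdef]; positivity),
    ENNReal.ofReal_le_ofReal_iff Q0, ← intervalIntegral.integral_of_le hab.le,
    intervalIntegral.integral_const_mul, dΓ] at fatou
  rw [dΓ, dκ]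
  simp only [hQ, hΨ] at fatou
  linarith

/-- Cauchy-Schwarz inequality on an interval. -/
lemma sq_integral_le {f : ℝ → ℝ} {s t : ℝ} (hst : s < t) (hf : IntervalIntegrable f volume s t)
    (hf2 : IntervalIntegrable (fun p => f p ^ 2) volume s t) :
    (∫ p in s..t, f p) ^ 2 ≤ (t - s) * ∫ p in s..t, f p ^ 2 := by
  set I := ∫ p in s..t, f p with hI
  set m := (t - s)⁻¹ * I with hm
  have h0 : 0 ≤ ∫ p in s..t, (f p ^ 2 - (2 * m * f p - m ^ 2)) :=
    intervalIntegral.integral_nonneg hst.le fun p _ => by nlinarith [sq_nonneg (f p - m)]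
  rw [intervalIntegral.integral_sub hf2 ((hf.const_mul _).sub intervalIntegrable_const),
    intervalIntegral.integral_sub (hf.const_mul _) intervalIntegrable_const,
    intervalIntegral.integral_const_mul, intervalIntegral.integral_const, smul_eq_mul] at h0
  have hts : 0 < t - s := sub_pos.2 hst
  have e : 2 * m * I - (t - s) * m ^ 2 = (t - s)⁻¹ * I ^ 2 := by
    rw [hm]; field_simp; ring
  rw [← hI, e] at h0
  have := mul_le_mul_of_nonneg_left (sub_nonneg.1 h0) hts.le
  rwa [mul_inv_cancel_left₀ hts.ne'] at this

end TimeAnalysis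

section Functionals

variable {Om : Set E3}

lemma lintegral_comp_le_liminf {betah : ℝ → ℝ≥0∞} (hb : LowerSemicontinuous betah)
    {v : ℕ → Hs Om} {w : Hs Om} (hv : Tendsto v atTop (𝓝 w)) {c : ℝ≥0∞}
    (hc : ∀ n, ∫⁻ x, betah (v n x) ∂(mOm Om) ≤ c) :
    ∫⁻ x, betah (w x) ∂(mOm Om) ≤ c := by
  obtain ⟨ns, -, hae⟩ := (tendstoInMeasure_of_tendsto_Lp hv).exists_seq_tendsto_ae
  calc ∫⁻ x, betah (w x) ∂(mOm Om)
      ≤ ∫⁻ x, liminf (fun n => betah (v (ns n) x)) atTop ∂(mOm Om) := by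
        refine lintegral_mono_ae ?_
        filter_upwards [hae] with x hx
        refine le_of_forall_lt fun d hd => ?_
        obtain ⟨e, hde, he⟩ := exists_between hd
        refine lt_of_lt_of_le hde (le_liminf_of_le (by isBoundedDefault) ?_)
        exact (hx.eventually (hb (w x) e he)).mono fun _ h => h.le
    _ ≤ liminf (fun n => ∫⁻ x, betah (v (ns n) x) ∂(mOm Om)) atTop :=
        lintegral_liminf_le' fun n =>
          hb.measurable.comp_aemeasurable (Lp.aestronglyMeasurable _).aemeasurable
    _ ≤ c := liminf_le_of_le (by isBoundedDefault) fun d hd => by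
        obtain ⟨n, hn⟩ := hd.exists
        exact hn.trans (hc _)

lemma lowerSemicontinuous_lintegral_comp {betah : ℝ → ℝ≥0∞} (hb : LowerSemicontinuous betah) :
    LowerSemicontinuous fun v : Hs Om => ∫⁻ x, betah (v x) ∂(mOm Om) := by
  rw [lowerSemicontinuous_iff_isClosed_preimage]
  intro c
  refine IsSeqClosed.isClosed fun v w hv hlim => ?_
  exact lintegral_comp_le_liminf hb hlim hv

lemma aemeasurable_lintegral_comp {betah : ℝ → ℝ≥0∞} (hb : LowerSemicontinuous betah)
    {y : ℝ → Hs Om} {ν : Measure ℝ} (hy : AEStronglyMeasurable y ν) :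
    AEMeasurable (fun t => ∫⁻ x, betah (y t x) ∂(mOm Om)) ν := by
  let _ : MeasurableSpace (Hs Om) := borel _
  have : BorelSpace (Hs Om) := ⟨rfl⟩
  exact (lowerSemicontinuous_lintegral_comp hb).measurable.comp_aemeasurable hy.aemeasurable

lemma abs_taylor_le {pih piF : ℝ → ℝ} {L : ℝ≥0} (hd : ∀ s, HasDerivAt pih (piF s) s)
    (hL : LipschitzWith L piF) (a b : ℝ) :
    |pih a - pih b - piF a * (a - b)| ≤ L * (a - b) ^ 2 := by
  have h := Convex.norm_image_sub_le_of_norm_hasDerivWithin_le (s := uIcc a b)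
    (f := fun x => pih x - piF a * x) (f' := fun x => piF x - piF a) (C := L * |a - b|)
    (x := b) (y := a) (fun x _ => by
      have := ((hd x).sub ((hasDerivAt_id x).const_mul (piF a))).hasDerivWithinAt (s := uIcc a b)
      rw [mul_one] at this
      exact this)
    (fun x hx => by
      refine (hL.norm_sub_le x a).trans ?_
      gcongr
      rw [abs_sub_comm a b, Real.norm_eq_abs]
      exact Set.abs_sub_left_of_mem_uIcc hx)
    (convex_uIcc a b) right_mem_uIcc left_mem_uIcc
  rw [Real.norm_eq_abs, Real.norm_eq_abs, mul_assoc, ← sq, sq_abs] at h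
  convert h using 2
  ring

lemma real_inner_eq_mul (a b : ℝ) : ⟪a, b⟫ = a * b := by
  rw [RCLike.inner_apply, conj_trivial, mul_comm]

lemma integral_mul_eq_inner {p : ℝ → ℝ} {N : Hs Om → Hs Om}
    (hN : ∀ v, ∀ᵐ x ∂(mOm Om), N v x = p (v x)) (y u v : Hs Om) :
    ∫ x, (p (y x) - u x) * (y x - v x) ∂(mOm Om) = ⟪N y - u, y - v⟫ := by
  rw [L2.inner_def]
  refine integral_congr_ae ?_
  filter_upwards [hN y, Lp.coeFn_sub (N y) u, Lp.coeFn_sub y v] with x h1 h2 h3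
  rw [h2, h3, Pi.sub_apply, Pi.sub_apply, h1, real_inner_eq_mul]

lemma integrable_sq_coe (v : Hs Om) : Integrable (fun x => v x ^ 2) (mOm Om) :=
  (Lp.memLp v).integrable_sq

lemma integral_sq_coe (v : Hs Om) : ∫ x, v x ^ 2 ∂(mOm Om) = ‖v‖ ^ 2 := by
  rw [← real_inner_self_eq_norm_sq, L2.inner_def]
  simp only [real_inner_eq_mul, sq]

variable [IsFiniteMeasure (mOm Om)]

/-- The Nemytskii operator of a Lipschitz function. -/
lemma exists_nemytskii {p : ℝ → ℝ} {L : ℝ≥0} (hL : LipschitzWith L p) :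
    ∃ N : Hs Om → Hs Om, (∀ v, ∀ᵐ x ∂(mOm Om), N v x = p (v x)) ∧ LipschitzWith L N := by
  have h1 : LipschitzWith L fun s => p s - p 0 :=
    LipschitzWith.of_dist_le_mul fun s t => by
      simpa [Real.dist_eq] using hL.dist_le_mul s t
  have h0 : p 0 - p 0 = 0 := sub_self _
  refine ⟨fun v => h1.compLp h0 v + Lp.const 2 (mOm Om) (p 0), fun v => ?_, ?_⟩
  · filter_upwards [Lp.coeFn_add (h1.compLp h0 v) (Lp.const 2 (mOm Om) (p 0)),
      h1.coeFn_compLp h0 v, Lp.coeFn_const (p := 2) (μ := mOm Om) (c := p 0)] with x e1 e2 e3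
    rw [e1, Pi.add_apply, e2, e3]
    simp [Function.comp]
  · refine LipschitzWith.of_dist_le_mul fun v w => ?_
    rw [dist_add_right]
    exact (h1.lipschitzWith_compLp h0).dist_le_mul v w

lemma integrable_coe (v : Hs Om) : Integrable (fun x => v x) (mOm Om) :=
  (Lp.memLp v).integrable one_le_two

lemma integrable_potential {pih piF : ℝ → ℝ} {L : ℝ≥0} (hd : ∀ s, HasDerivAt pih (piF s) s)
    (hL : LipschitzWith L piF) (v : Hs Om) : Integrable (fun x => pih (v x)) (mOm Om) := by
  have hc : Continuous pih := continuous_iff_continuousAt.2 fun s => (hd s).continuousAt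
  refine Integrable.mono' (g := fun x => |pih 0| + |piF 0| * |v x| + L * v x ^ 2)
    (((integrable_const _).add ((integrable_coe v).abs.const_mul _)).add
      ((integrable_sq_coe v).const_mul _))
    (hc.comp_aestronglyMeasurable (Lp.aestronglyMeasurable v)) (Eventually.of_forall fun x => ?_)
  have h := abs_le.1 (abs_taylor_le hd hL 0 (v x))
  have h1 := neg_abs_le (pih 0)
  have h2 := le_abs_self (pih 0)
  have h3 := abs_le.1 (abs_mul (piF 0) (v x)).le
  rw [Real.norm_eq_abs, abs_le]
  constructor <;> nlinarith

lemma potential_taylor {pih piF : ℝ → ℝ} {L : ℝ≥0} (hd : ∀ s, HasDerivAt pih (piF s) s)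
    (hL : LipschitzWith L piF) {N : Hs Om → Hs Om}
    (hN : ∀ v, ∀ᵐ x ∂(mOm Om), N v x = piF (v x)) (y v : Hs Om) :
    |(∫ x, pih (y x) ∂(mOm Om)) - (∫ x, pih (v x) ∂(mOm Om)) - ⟪N y, y - v⟫|
      ≤ L * ‖y - v‖ ^ 2 := by
  have i1 : Integrable (fun x => pih (y x) - pih (v x)) (mOm Om) :=
    (integrable_potential hd hL y).sub (integrable_potential hd hL v)
  rw [← integral_sub (integrable_potential hd hL y) (integrable_potential hd hL v), L2.inner_def,
    ← integral_sub i1 (L2.integrable_inner _ _), ← integral_sq_coe, ← integral_const_mul]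
  refine abs_integral_le_integral_abs.trans ?_
  refine integral_mono_of_nonneg (Eventually.of_forall fun x => abs_nonneg _)
    ((integrable_sq_coe _).const_mul _) ?_
  filter_upwards [hN y, Lp.coeFn_sub y v] with x h1 h3
  rw [h3, Pi.sub_apply, h1, real_inner_eq_mul]
  exact abs_taylor_le hd hL (y x) (v x)

lemma continuous_potential {pih piF : ℝ → ℝ} {L : ℝ≥0} (hd : ∀ s, HasDerivAt pih (piF s) s)
    (hL : LipschitzWith L piF) :
    Continuous fun v : Hs Om => ∫ x, pih (v x) ∂(mOm Om) := by
  obtain ⟨N, hN, -⟩ := exists_nemytskii (Om := Om) hL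
  rw [continuous_iff_continuousAt]
  intro y
  rw [ContinuousAt, tendsto_iff_dist_tendsto_zero]
  have hlim : Tendsto (fun v : Hs Om => ‖N y‖ * ‖y - v‖ + L * ‖y - v‖ ^ 2) (𝓝 y) (𝓝 0) := by
    have : Continuous fun v : Hs Om => ‖N y‖ * ‖y - v‖ + L * ‖y - v‖ ^ 2 := by fun_prop
    simpa using this.tendsto y
  refine squeeze_zero (fun _ => dist_nonneg) (fun v => ?_) hlim
  have h := potential_taylor hd hL hN y v
  have h2 := abs_real_inner_le_norm (N y) (y - v)
  rw [Real.dist_eq, abs_sub_comm]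
  have h3 := abs_add_le ((∫ x, pih (y x) ∂(mOm Om)) - (∫ x, pih (v x) ∂(mOm Om)) - ⟪N y, y - v⟫)
    ⟪N y, y - v⟫
  rw [sub_add_cancel] at h3
  linarith

/-- Coercivity of the total potential. -/
lemma exists_coercive {betah : ℝ → ℝ≥0∞} {pih piF : ℝ → ℝ} {L : ℝ≥0}
    (hd : ∀ s, HasDerivAt pih (piF s) s) (hL : LipschitzWith L piF)
    {α : ℝ} (hα : ∀ᶠ s : ℝ in Filter.comap (|·|) atTop,
      ENNReal.ofReal (α * s ^ 2 - pih s) ≤ betah s) :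
    ∃ K : ℝ, ∀ v : Hs Om, (∫⁻ x, betah (v x) ∂(mOm Om)) < ⊤ →
      α * ‖v‖ ^ 2 - K ≤ (∫ x, pih (v x) ∂(mOm Om)) + (∫⁻ x, betah (v x) ∂(mOm Om)).toReal := by
  obtain ⟨S, hS, hSα⟩ := hα
  obtain ⟨R, hR⟩ := mem_atTop_sets.1 hS
  have hc : Continuous pih := continuous_iff_continuousAt.2 fun s => (hd s).continuousAt
  obtain ⟨K, hK⟩ := (isCompact_Icc (a := -R) (b := R)).bddAbove_image
    (f := fun s => α * s ^ 2 - pih s) (by fun_prop)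
  have hpt : ∀ s, ENNReal.ofReal (α * s ^ 2 - max K 0 - pih s) ≤ betah s := by
    intro s
    by_cases hs : R ≤ |s|
    · refine le_trans (ENNReal.ofReal_le_ofReal ?_) (hSα (hR _ hs))
      linarith [le_max_right K 0]
    · have hs' : s ∈ Icc (-R) R := abs_le.1 (not_le.1 hs).le
      rw [ENNReal.ofReal_of_nonpos]
      · exact bot_le
      · have := hK ⟨s, hs', rfl⟩
        simp only at this
        linarith [le_max_left K 0]
  refine ⟨max K 0 * (mOm Om).real univ, fun v hv => ?_⟩
  have i1 : Integrable (fun x => α * v x ^ 2 - max K 0) (mOm Om) :=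
    ((integrable_sq_coe v).const_mul _).sub (integrable_const _)
  have i2 := integrable_potential hd hL v
  have key : ∫ x, (α * v x ^ 2 - max K 0 - pih (v x)) ∂(mOm Om)
      ≤ (∫⁻ x, betah (v x) ∂(mOm Om)).toReal := by
    have i3 : Integrable (fun x => max (α * v x ^ 2 - max K 0 - pih (v x)) 0) (mOm Om) :=
      (i1.sub i2).pos_part
    refine (integral_mono (i1.sub i2) i3 fun x => le_max_left _ 0).trans ?_
    have h0 : 0 ≤ᵐ[mOm Om] fun x => max (α * v x ^ 2 - max K 0 - pih (v x)) 0 :=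
      Eventually.of_forall fun x => le_max_right _ _
    rw [integral_eq_lintegral_of_nonneg_ae h0 i3.aestronglyMeasurable]
    refine ENNReal.toReal_mono hv.ne (lintegral_mono fun x => ?_)
    rw [ENNReal.ofReal_max, ENNReal.ofReal_zero]
    exact max_le (hpt _) bot_le
  rw [integral_sub i1 i2, integral_sub ((integrable_sq_coe v).const_mul _) (integrable_const _),
    integral_const_mul, integral_sq_coe, integral_const, smul_eq_mul] at key
  linarith

end Functionals

section Trajectories

variable {Om : Set E3}

lemma aestronglyMeasurable_fracPow {lam : ℕ → ℝ} {ρ : ℝ} (b : HilbertBasis ℕ ℝ (Hs Om))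
    {ν : Measure ℝ} {v : ℝ → Hs Om} (hv : AEStronglyMeasurable v ν)
    (hdom : ∀ᵐ t ∂ν, inDom lam b ρ (v t)) :
    AEStronglyMeasurable (fun t => fracPow lam b ρ (v t)) ν := by
  refine aestronglyMeasurable_of_tendsto_ae atTop
    (f := fun n t => ∑ j ∈ Finset.range n, ((lam j) ^ ρ * ⟪v t, b j⟫) • b j) (fun n => ?_) ?_
  · refine Finset.aestronglyMeasurable_fun_sum _ fun j _ => ?_
    exact ((hv.inner aestronglyMeasurable_const).const_mul _).smul_const _
  · filter_upwards [hdom] with t ht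
    exact (ht.hasSum_fracPow b).tendsto_sum_nat

/-- The properties of a solution that govern its long time behaviour.  The function `g` is
`A^r μ`, `J` is the convex integral functional and `N` is the perturbation of its
subdifferential. -/
structure Trajectory (bA bB : HilbertBasis ℕ ℝ (Hs Om)) (lamA lamB : ℕ → ℝ) (r σ τ : ℝ)
    (J : Hs Om → ℝ≥0∞) (N : Hs Om → Hs Om) (u y μ g z : ℝ → Hs Om) : Prop where
  g_eq : ∀ t, g t = fracPow lamA bA r (μ t)
  meas_g : AEStronglyMeasurable g (volume.restrict (Ioi (0:ℝ)))
  sq_g : ∀ T : ℝ, 0 < T → IntegrableOn (fun t => ‖g t‖ ^ 2) (Ioc 0 T)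
  meas_z : AEStronglyMeasurable z (volume.restrict (Ioi (0:ℝ)))
  sq_z : ∀ T : ℝ, 0 < T → IntegrableOn (fun t => ‖z t‖ ^ 2) (Ioc 0 T)
  meas_y : AEStronglyMeasurable y (volume.restrict (Ioi (0:ℝ)))
  weak : ∀ v, inDom lamA bA r v → ∀ s t, 0 ≤ s → s ≤ t →
    ⟪y t - y s, v⟫ = -∫ p in s..t, ⟪g p, fracPow lamA bA r v⟫
  z_eq : ∀ᵐ t ∂(volume.restrict (Ioi (0:ℝ))), ∀ v, inDom lamA bA r v →
    ⟪z t, v⟫ = -(τ * ⟪g t, fracPow lamA bA r v⟫)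
  dom_mu : ∀ᵐ t ∂(volume.restrict (Ioi (0:ℝ))), inDom lamA bA r (μ t)
  dom_y : ∀ᵐ t ∂(volume.restrict (Ioi (0:ℝ))), inDom lamB bB σ (y t)
  bdd_y : ∀ T : ℝ, 0 < T → ∃ C : ℝ,
    ∀ᵐ t ∂(volume.restrict (Ioc (0:ℝ) T)), gnormSq lamB bB σ (y t) ≤ C
  J_lt_top : ∀ᵐ t ∂(volume.restrict (Ioi (0:ℝ))), J (y t) < ⊤
  int_J : ∀ T : ℝ, 0 < T → IntegrableOn (fun t => (J (y t)).toReal) (Ioc 0 T)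
  ineq : ∀ᵐ t ∂(volume.restrict (Ioi (0:ℝ))), ∀ v, inDom lamB bB σ v → J v < ⊤ →
    ⟪z t, y t - v⟫ + ⟪fracPow lamB bB σ (y t), fracPow lamB bB σ (y t) - fracPow lamB bB σ v⟫
      + (J (y t)).toReal + ⟪N (y t) - u t, y t - v⟫ ≤ ⟪μ t, y t - v⟫ + (J v).toReal

lemma ae_Ioi_of_forall_ae_Ioc {p : ℝ → Prop}
    (h : ∀ T : ℝ, 0 < T → ∀ᵐ t ∂(volume.restrict (Ioc (0:ℝ) T)), p t) :
    ∀ᵐ t ∂(volume.restrict (Ioi (0:ℝ))), p t := by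
  have h1 : ∀ n : ℕ, ∀ᵐ t : ℝ, t ∈ Ioc (0:ℝ) (n + 1) → p t := fun n =>
    (ae_restrict_iff' measurableSet_Ioc).1 (h _ (by positivity))
  rw [ae_restrict_iff' measurableSet_Ioi]
  filter_upwards [ae_all_iff.2 h1] with t ht h0
  obtain ⟨n, hn⟩ := exists_nat_ge t
  exact ht n ⟨h0, hn.trans (by linarith)⟩

lemma IsSolution.trajectory {lamA lamB : ℕ → ℝ} {bA bB : HilbertBasis ℕ ℝ (Hs Om)} {r σ τ : ℝ}
    {betah : ℝ → ℝ≥0∞} {piF : ℝ → ℝ} {N : Hs Om → Hs Om} {u : ℝ → Hs Om} {y0 : Hs Om}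
    {y μ : ℝ → Hs Om} {dy : ℝ → Hs Om →ₗ[ℝ] ℝ} {z : ℝ → Hs Om}
    (hb : LowerSemicontinuous betah) (hN : ∀ v, ∀ᵐ x ∂(mOm Om), N v x = piF (v x))
    (h : IsSolution Om lamA lamB bA bB r σ τ betah piF u y0 y μ dy z) :
    Trajectory bA bB lamA lamB r σ τ (fun v => ∫⁻ x, betah (v x) ∂(mOm Om)) N u y μ
      (fun t => fracPow lamA bA r (μ t)) z := by
  obtain ⟨h1, h2, h3, h4, h5, -, h7, h8, h9, h10, h11, h12, h13, h14, h15, -⟩ := h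
  have hmg := aestronglyMeasurable_fracPow bA h10 h11
  have sub : ∀ T : ℝ, Ioc 0 T ⊆ Ioi 0 := fun T => Ioc_subset_Ioi_self
  have key : ∀ v, inDom lamA bA r v → ∀ s t : ℝ, 0 ≤ s → s ≤ t →
      ∫ p in s..t, dy p v
        = -∫ p in s..t, ⟪fracPow lamA bA r (μ p), fracPow lamA bA r v⟫ := by
    intro v hv s t hs hst
    rw [← intervalIntegral.integral_neg]
    refine intervalIntegral.integral_congr_ae ?_
    have := (ae_restrict_iff' measurableSet_Ioi).1 h14
    filter_upwards [this] with p hp hpm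
    rw [uIoc_of_le hst] at hpm
    linarith [hp (hs.trans_lt hpm.1) v hv]
  have hint : ∀ v, inDom lamA bA r v → ∀ t : ℝ, 0 ≤ t →
      IntervalIntegrable (fun p => dy p v) volume 0 t := by
    intro v hv t ht
    rw [intervalIntegrable_iff_integrableOn_Ioc_of_le ht]
    exact (h4 v hv (t + 1) (by linarith)).mono_set (Ioc_subset_Ioc_right (by linarith))
  refine ⟨fun _ => rfl, hmg, fun T hT => ?_, h7, h9, h1, fun v hv s t hs hst => ?_, ?_, h11, h2,
    h3, ?_, fun T hT => ?_, ?_⟩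
  · refine Integrable.mono' (h12 T hT) ((hmg.mono_set (sub T)).norm.pow 2)
      (Eventually.of_forall fun t => ?_)
    rw [Real.norm_of_nonneg (sq_nonneg _)]
    exact le_add_of_nonneg_left (sq_nonneg _)
  · rw [inner_sub_left, h5 v hv t (hs.trans hst), h5 v hv s hs, ← key v hv s t hs hst,
      ← intervalIntegral.integral_interval_sub_left (hint v hv t (hs.trans hst)) (hint v hv s hs)]
    ring
  · filter_upwards [h8, h14] with t e1 e2 v hv
    rw [e1 v hv, ← mul_neg]
    congr 1
    linarith [e2 v hv]
  · refine ae_Ioi_of_forall_ae_Ioc fun T hT => ?_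
    exact ae_lt_top' (aemeasurable_lintegral_comp hb (h1.mono_set (sub T))) (h13 T hT).ne
  · exact integrable_toReal_of_lintegral_ne_top
      (aemeasurable_lintegral_comp hb (h1.mono_set (sub T))) (h13 T hT).ne
  · filter_upwards [h15] with t ht v hv hJ
    rw [← integral_mul_eq_inner hN]
    exact ht v hv hJ

end Trajectories

lemma integrable_of_sq {α X : Type*} [MeasurableSpace α] [NormedAddCommGroup X] {ν : Measure α}
    [IsFiniteMeasure ν] {f : α → X} (hf : AEStronglyMeasurable f ν)
    (hf2 : Integrable (fun t => ‖f t‖ ^ 2) ν) : Integrable f ν := by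
  refine Integrable.mono' ((integrable_const (1:ℝ)).add hf2) hf (Eventually.of_forall fun t => ?_)
  simp only [Pi.add_apply]
  nlinarith [sq_nonneg (‖f t‖ - 1)]

lemma exists_seq_of_ae_Ioo {P : ℝ → Prop} {p q t : ℝ} (h : ∀ᵐ s, s ∈ Ioo p q → P s)
    (ht : t ∈ Ioo p q) :
    ∃ s : ℕ → ℝ, Tendsto s atTop (𝓝 t) ∧ ∀ n, s n ∈ Ioo p q ∧ P (s n) := by
  have hd := Measure.dense_of_ae h
  obtain ⟨s, hs, hlim⟩ := mem_closure_iff_seq_limit.1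
    (hd.open_subset_closure_inter isOpen_Ioo ht)
  exact ⟨s, hlim, fun n => ⟨(hs n).1, (hs n).2 (hs n).1⟩⟩

section Trajectories

variable {Om : Set E3} {bA bB : HilbertBasis ℕ ℝ (Hs Om)} {lamA lamB : ℕ → ℝ} {r σ τ : ℝ}
  {J : Hs Om → ℝ≥0∞} {N : Hs Om → Hs Om} {u y μ g z : ℝ → Hs Om}

namespace Trajectory

lemma intervalIntegrable_sq_g (h : Trajectory bA bB lamA lamB r σ τ J N u y μ g z) {s t : ℝ}
    (hs : 0 ≤ s) (hst : s ≤ t) : IntervalIntegrable (fun p => ‖g p‖ ^ 2) volume s t := by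
  rw [intervalIntegrable_iff_integrableOn_Ioc_of_le hst]
  exact (h.sq_g (t + 1) (by linarith)).mono_set (Ioc_subset_Ioc hs (by linarith))

lemma intervalIntegrable_g (h : Trajectory bA bB lamA lamB r σ τ J N u y μ g z) {s t : ℝ}
    (hs : 0 ≤ s) (hst : s ≤ t) : IntervalIntegrable g volume s t := by
  have h2 := h.intervalIntegrable_sq_g hs hst
  rw [intervalIntegrable_iff_integrableOn_Ioc_of_le hst] at *
  exact integrable_of_sq (h.meas_g.mono_set fun p hp => hs.trans_lt hp.1) h2

lemma intervalIntegrable_sq_z (h : Trajectory bA bB lamA lamB r σ τ J N u y μ g z) {s t : ℝ}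
    (hs : 0 ≤ s) (hst : s ≤ t) : IntervalIntegrable (fun p => ‖z p‖ ^ 2) volume s t := by
  rw [intervalIntegrable_iff_integrableOn_Ioc_of_le hst]
  exact (h.sq_z (t + 1) (by linarith)).mono_set (Ioc_subset_Ioc hs (by linarith))

lemma intervalIntegrable_z (h : Trajectory bA bB lamA lamB r σ τ J N u y μ g z) {s t : ℝ}
    (hs : 0 ≤ s) (hst : s ≤ t) : IntervalIntegrable z volume s t := by
  have h2 := h.intervalIntegrable_sq_z hs hst
  rw [intervalIntegrable_iff_integrableOn_Ioc_of_le hst] at *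
  exact integrable_of_sq (h.meas_z.mono_set fun p hp => hs.trans_lt hp.1) h2

lemma intervalIntegrable_inner {f : ℝ → Hs Om} {s t : ℝ} (hf : IntervalIntegrable f volume s t)
    (v : Hs Om) : IntervalIntegrable (fun p => ⟪f p, v⟫) volume s t :=
  ⟨hf.1.inner_const v, hf.2.inner_const v⟩

lemma inner_increment_sq_le (h : Trajectory bA bB lamA lamB r σ τ J N u y μ g z) {v : Hs Om}
    (hv : inDom lamA bA r v) {s t : ℝ} (hs : 0 ≤ s) (hst : s ≤ t) :
    ⟪y t - y s, v⟫ ^ 2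
      ≤ ‖fracPow lamA bA r v‖ ^ 2 * ((t - s) * ∫ p in s..t, ‖g p‖ ^ 2) := by
  rw [h.weak v hv s t hs hst, neg_sq]
  have i2 := h.intervalIntegrable_sq_g hs hst
  have ig := (h.intervalIntegrable_g hs hst).norm
  rcases hst.eq_or_lt with rfl | hlt
  · simp
  have h1 : |∫ p in s..t, ⟪g p, fracPow lamA bA r v⟫|
      ≤ ‖fracPow lamA bA r v‖ * ∫ p in s..t, ‖g p‖ := by
    rw [← intervalIntegral.integral_const_mul]
    refine (intervalIntegral.abs_integral_le_integral_abs hst).trans ?_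
    refine intervalIntegral.integral_mono_on hst
      (intervalIntegrable_inner (h.intervalIntegrable_g hs hst) _).abs (ig.const_mul _)
      fun p _ => ?_
    rw [mul_comm]
    exact abs_real_inner_le_norm _ _
  calc (∫ p in s..t, ⟪g p, fracPow lamA bA r v⟫) ^ 2
      = |∫ p in s..t, ⟪g p, fracPow lamA bA r v⟫| ^ 2 := (sq_abs _).symm
    _ ≤ (‖fracPow lamA bA r v‖ * ∫ p in s..t, ‖g p‖) ^ 2 := by gcongr
    _ = ‖fracPow lamA bA r v‖ ^ 2 * (∫ p in s..t, ‖g p‖) ^ 2 := mul_pow _ _ _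
    _ ≤ _ := by
        gcongr
        exact sq_integral_le hlt ig i2

lemma tendsto_inner_increment (h : Trajectory bA bB lamA lamB r σ τ J N u y μ g z) {v : Hs Om}
    (hv : inDom lamA bA r v) {s : ℕ → ℝ} {t : ℝ} (hs : ∀ n, 0 ≤ s n) (ht : 0 ≤ t)
    (hlim : Tendsto s atTop (𝓝 t)) :
    Tendsto (fun n => ⟪y (s n) - y t, v⟫) atTop (𝓝 0) := by
  obtain ⟨T, hT⟩ := hlim.bddAbove_range
  have hsT : ∀ n, s n ≤ max T t := fun n => (hT ⟨n, rfl⟩).trans (le_max_left _ _)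
  have htT : t ≤ max T t := le_max_right _ _
  set Q := ∫ p in (0:ℝ)..(max T t), ‖g p‖ ^ 2 with hQ
  have mono : ∀ a b, 0 ≤ a → a ≤ b → b ≤ max T t → ∫ p in a..b, ‖g p‖ ^ 2 ≤ Q := by
    intro a b ha hab hb
    exact intervalIntegral.integral_mono_interval ha hab hb
      (Eventually.of_forall fun _ => sq_nonneg _)
      (h.intervalIntegrable_sq_g le_rfl (ht.trans htT))
  have hlim2 : Tendsto (fun n => ‖fracPow lamA bA r v‖ ^ 2 * (|s n - t| * Q)) atTop (𝓝 0) := by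
    have : Tendsto (fun n => |s n - t|) atTop (𝓝 0) := by
      simpa using (hlim.sub_const t).abs
    simpa using (this.mul_const Q).const_mul (‖fracPow lamA bA r v‖ ^ 2)
  have h2 : Tendsto (fun n => ⟪y (s n) - y t, v⟫ ^ 2) atTop (𝓝 0) := by
    refine squeeze_zero (fun _ => sq_nonneg _) (fun n => ?_) hlim2
    rcases le_total (s n) t with hle | hle
    · have := h.inner_increment_sq_le hv (hs n) hle
      rw [← neg_sub (y t), inner_neg_left, neg_sq, abs_sub_comm, abs_of_nonneg (sub_nonneg.2 hle)]
      refine this.trans ?_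
      have h0 := sub_nonneg.2 hle
      gcongr
      exact mono _ _ (hs n) hle htT
    · have := h.inner_increment_sq_le hv ht hle
      rw [abs_of_nonneg (sub_nonneg.2 hle)]
      refine this.trans ?_
      have h0 := sub_nonneg.2 hle
      gcongr
      exact mono _ _ ht hle (hsT n)
  have h3 := h2.sqrt
  simp only [Real.sqrt_sq_eq_abs, Real.sqrt_zero] at h3
  exact (tendsto_zero_iff_abs_tendsto_zero _).2 h3

/-- Almost everywhere bounds in the graph norm hold everywhere. -/
lemma bound_of_ae (h : Trajectory bA bB lamA lamB r σ τ J N u y μ g z) {p q C : ℝ} (hp : 0 ≤ p)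
    (hC : ∀ᵐ t, t ∈ Ioo p q → gnormSq lamB bB σ (y t) ≤ C) {t : ℝ} (ht : t ∈ Ioo p q) :
    inDom lamB bB σ (y t) ∧ gnormSq lamB bB σ (y t) ≤ C := by
  have hgood : ∀ᵐ s, s ∈ Ioo p q → inDom lamB bB σ (y s) ∧ gnormSq lamB bB σ (y s) ≤ C := by
    filter_upwards [hC, (ae_restrict_iff' measurableSet_Ioi).1 h.dom_y] with s h1 h2 hs
    exact ⟨h2 (hp.trans_lt hs.1), h1 hs⟩
  obtain ⟨s, hlim, hs⟩ := exists_seq_of_ae_Ioo hgood ht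
  refine inDom_of_tendsto bB (fun n => (hs n).2.1) (fun n => (hs n).2.2) fun j => ?_
  have hbd : ∀ n, ‖y (s n) - y t‖ ≤ √C + ‖y t‖ := fun n => by
    refine (norm_sub_le _ _).trans (add_le_add_left (Real.le_sqrt_of_sq_le ?_) _)
    exact (le_add_of_nonneg_right (sq_nonneg _)).trans (hs n).2.2
  have := tendsto_inner_of_dense (dense_inDom (lam := lamA) (ρ := r) bA) hbd
    (fun v hv => h.tendsto_inner_increment hv (fun n => hp.trans (hs n).1.1.le)
      (hp.trans ht.1.le) hlim) (bB j)
  simp only [inner_sub_left] at this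
  simpa using this.add_const ⟪y t, bB j⟫

/-- An interpolation inequality for the increments of a trajectory. -/
lemma increment_sq_le (h : Trajectory bA bB lamA lamB r σ τ J N u y μ g z)
    (hpos : ∀ j, 0 ≤ lamB j) (hmono : Monotone lamB) (hlam : Tendsto lamB atTop atTop)
    (hσ : 0 < σ) {ε : ℝ} (hε : 0 < ε) :
    ∃ C : ℝ, 0 ≤ C ∧ ∀ s t, 0 ≤ s → s ≤ t → inDom lamB bB σ (y t - y s) →
      ‖y t - y s‖ ^ 2 ≤ ε * ‖fracPow lamB bB σ (y t - y s)‖ ^ 2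
        + C * ((t - s) * ∫ p in s..t, ‖g p‖ ^ 2) := by
  have hl : Tendsto (fun n => ((lamB n ^ σ) ^ 2)⁻¹) atTop (𝓝 0) :=
    (((tendsto_pow_atTop two_ne_zero).comp (_root_.tendsto_rpow_atTop hσ)).comp hlam).inv_tendsto_atTop
  obtain ⟨M, hM1, hM2⟩ := ((hl.eventually (ge_mem_nhds (half_pos hε))).and
    (hlam.eventually_gt_atTop 0)).exists
  have hδ : (0:ℝ) < 1 / (4 * (M + 1)) := by positivity
  have hv : ∀ j, ∃ v, inDom lamA bA r v ∧ ‖bB j - v‖ ^ 2 ≤ 1 / (4 * (M + 1)) := by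
    intro j
    obtain ⟨v, hv, hd⟩ := (dense_inDom (lam := lamA) (ρ := r) bA).exists_dist_lt (bB j)
      (Real.sqrt_pos.2 hδ)
    refine ⟨v, hv, ?_⟩
    rw [dist_eq_norm] at hd
    exact ((Real.lt_sqrt (norm_nonneg _)).1 hd).le
  choose v hvd hvn using hv
  refine ⟨4 * ∑ j ∈ Finset.range M, ‖fracPow lamA bA r (v j)‖ ^ 2, by positivity,
    fun s t hs hst hw => ?_⟩
  set w := y t - y s with hw0
  set X := (t - s) * ∫ p in s..t, ‖g p‖ ^ 2 with hX
  have h1 := norm_sq_le_sum_add_fracPow bB hpos hmono hσ hw M hM2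
  have h2 : ∀ j ∈ Finset.range M, ⟪w, bB j⟫ ^ 2
      ≤ 2 * (‖fracPow lamA bA r (v j)‖ ^ 2 * X) + 2 * (‖w‖ ^ 2 * (1 / (4 * (M + 1)))) := by
    intro j _
    have e : ⟪w, bB j⟫ = ⟪w, v j⟫ + ⟪w, bB j - v j⟫ := by rw [inner_sub_right]; ring
    have e1 := h.inner_increment_sq_le (hvd j) hs hst
    have e2 : ⟪w, bB j - v j⟫ ^ 2 ≤ ‖w‖ ^ 2 * (1 / (4 * (M + 1))) := by
      calc ⟪w, bB j - v j⟫ ^ 2 = |⟪w, bB j - v j⟫| ^ 2 := (sq_abs _).symm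
        _ ≤ (‖w‖ * ‖bB j - v j‖) ^ 2 := by gcongr; exact abs_real_inner_le_norm _ _
        _ = ‖w‖ ^ 2 * ‖bB j - v j‖ ^ 2 := mul_pow _ _ _
        _ ≤ _ := by gcongr; exact hvn j
    rw [e]
    nlinarith [sq_nonneg (⟪w, v j⟫ - ⟪w, bB j - v j⟫)]
  have h3 := Finset.sum_le_sum h2
  rw [Finset.sum_add_distrib, Finset.sum_const, Finset.card_range, nsmul_eq_mul, ← Finset.mul_sum,
    ← Finset.sum_mul] at h3
  have h4 : (M:ℝ) * (2 * (‖w‖ ^ 2 * (1 / (4 * (M + 1))))) ≤ ‖w‖ ^ 2 / 2 := by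
    have : (M:ℝ) * (2 * (‖w‖ ^ 2 * (1 / (4 * (M + 1))))) = ‖w‖ ^ 2 / 2 * (M / (M + 1)) := by
      field_simp; ring
    rw [this]
    refine mul_le_of_le_one_right (by positivity) ?_
    rw [div_le_one (by positivity)]
    linarith
  have h5 : ((lamB M ^ σ) ^ 2)⁻¹ * ‖fracPow lamB bB σ w‖ ^ 2
      ≤ ε / 2 * ‖fracPow lamB bB σ w‖ ^ 2 := by gcongr
  nlinarith

end Trajectory

end Trajectories

lemma intervalIntegral_inner {X : Type*} [NormedAddCommGroup X] [InnerProductSpace ℝ X]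
    [CompleteSpace X] {f : ℝ → X} {s t : ℝ} (hf : IntervalIntegrable f volume s t) (c : X) :
    ∫ p in s..t, ⟪c, f p⟫ = ⟪c, ∫ p in s..t, f p⟫ :=
  (innerSL ℝ c).intervalIntegral_comp_comm hf

lemma intervalIntegrable_const_inner {X : Type*} [NormedAddCommGroup X] [InnerProductSpace ℝ X]
    {f : ℝ → X} {s t : ℝ} (hf : IntervalIntegrable f volume s t) (c : X) :
    IntervalIntegrable (fun p => ⟪c, f p⟫) volume s t :=
  ⟨hf.1.const_inner c, hf.2.const_inner c⟩

section Primitive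

variable {X : Type*} [NormedAddCommGroup X] {u u' : ℝ → X}

lemma intervalIntegrable_of_integrableOn_Ioi (hu : IntegrableOn u' (Ioi (0:ℝ))) {s t : ℝ}
    (hs : 0 ≤ s) (hst : s ≤ t) : IntervalIntegrable u' volume s t := by
  rw [intervalIntegrable_iff_integrableOn_Ioc_of_le hst]
  exact hu.mono_set fun p hp => hs.trans_lt hp.1

lemma integral_norm_le_of_integrableOn_Ioi (hu : IntegrableOn u' (Ioi (0:ℝ))) {s t : ℝ}
    (hs : 0 ≤ s) (hst : s ≤ t) : ∫ p in s..t, ‖u' p‖ ≤ ∫ p in Ioi (0:ℝ), ‖u' p‖ := by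
  rw [intervalIntegral.integral_of_le hst]
  exact setIntegral_mono_set hu.norm (Eventually.of_forall fun _ => norm_nonneg _)
    (Eventually.of_forall fun p hp => hs.trans_lt hp.1)

variable [NormedSpace ℝ X]

lemma norm_sub_le_of_primitive (hu : IntegrableOn u' (Ioi (0:ℝ)))
    (hu2 : ∀ t : ℝ, 0 ≤ t → u t = u 0 + ∫ s in (0:ℝ)..t, u' s) {s t : ℝ} (hs : 0 ≤ s)
    (hst : s ≤ t) : ‖u t - u s‖ ≤ ∫ p in s..t, ‖u' p‖ := by
  rw [hu2 t (hs.trans hst), hu2 s hs, add_sub_add_left_eq_sub,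
    intervalIntegral.integral_interval_sub_left
      (intervalIntegrable_of_integrableOn_Ioi hu le_rfl (hs.trans hst))
      (intervalIntegrable_of_integrableOn_Ioi hu le_rfl hs)]
  exact intervalIntegral.norm_integral_le_integral_norm hst

lemma norm_le_of_primitive (hu : IntegrableOn u' (Ioi (0:ℝ)))
    (hu2 : ∀ t : ℝ, 0 ≤ t → u t = u 0 + ∫ s in (0:ℝ)..t, u' s) {t : ℝ} (ht : 0 ≤ t) :
    ‖u t‖ ≤ ‖u 0‖ + ∫ p in Ioi (0:ℝ), ‖u' p‖ := by
  have h1 := norm_sub_le_of_primitive hu hu2 le_rfl ht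
  have h2 := integral_norm_le_of_integrableOn_Ioi hu le_rfl ht
  have h3 := norm_sub_norm_le (u t) (u 0)
  linarith

lemma continuousOn_of_primitive (hu : IntegrableOn u' (Ioi (0:ℝ)))
    (hu2 : ∀ t : ℝ, 0 ≤ t → u t = u 0 + ∫ s in (0:ℝ)..t, u' s) : ContinuousOn u (Ici 0) := by
  have hi : Integrable ((Ioi (0:ℝ)).indicator u') := hu.integrable_indicator measurableSet_Ioi
  have hc := (intervalIntegral.continuous_primitive (fun _ _ => hi.intervalIntegrable) 0).const_add
    (u 0)
  refine hc.continuousOn.congr fun t ht => ?_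
  rw [hu2 t ht]
  congr 1
  refine intervalIntegral.integral_congr_ae (Eventually.of_forall fun p hp => ?_)
  rw [uIoc_of_le ht] at hp
  rw [indicator_of_mem (show p ∈ Ioi (0:ℝ) from hp.1)]

end Primitive

section Trajectories

variable {Om : Set E3} {bA bB : HilbertBasis ℕ ℝ (Hs Om)} {lamA lamB : ℕ → ℝ} {r σ τ : ℝ}
  {J : Hs Om → ℝ≥0∞} {N : Hs Om → Hs Om} {u u' y μ g z : ℝ → Hs Om}

/-- The free energy. -/
def energy (lamB : ℕ → ℝ) (bB : HilbertBasis ℕ ℝ (Hs Om)) (σ : ℝ) (J : Hs Om → ℝ≥0∞)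
    (P : Hs Om → ℝ) (v : Hs Om) : ℝ :=
  ‖fracPow lamB bB σ v‖ ^ 2 / 2 + (J v).toReal + P v

namespace Trajectory

lemma ae_inner_z (h : Trajectory bA bB lamA lamB r σ τ J N u y μ g z) (hτ : 0 ≤ τ) :
    ∀ᵐ t ∂(volume.restrict (Ioi (0:ℝ))), ∀ s₀ t₀, 0 ≤ s₀ → s₀ ≤ t₀ →
      ⟪z t, y t₀ - y s₀⟫ = τ⁻¹ * ∫ p in s₀..t₀, ⟪z t, z p⟫ := by
  filter_upwards [h.z_eq] with t ht s₀ t₀ hs hst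
  have hdense := dense_inDom (lam := lamA) (ρ := r) bA
  rcases hτ.eq_or_lt with rfl | hpos
  · have : z t = 0 := hdense.eq_zero_of_inner_left ℝ fun v hv => by
      rw [ht v hv]; ring
    simp [this]
  · have iz := h.intervalIntegrable_z hs hst
    have hw : y t₀ - y s₀ = τ⁻¹ • ∫ p in s₀..t₀, z p := by
      refine hdense.eq_of_inner_left ℝ fun v hv => ?_
      rw [h.weak v hv s₀ t₀ hs hst, real_inner_smul_left, real_inner_comm,
        ← intervalIntegral_inner iz, ← intervalIntegral.integral_const_mul,
        ← intervalIntegral.integral_neg]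
      refine intervalIntegral.integral_congr_ae ?_
      filter_upwards [(ae_restrict_iff' measurableSet_Ioi).1 h.z_eq] with p hp hpm
      rw [uIoc_of_le hst] at hpm
      rw [real_inner_comm (z p), hp (hs.trans_lt hpm.1) v hv]
      field_simp
    rw [hw, real_inner_smul_right, intervalIntegral_inner iz]

/-- The increments of the energy, up to an error which is small for small time steps. -/
lemma exists_energy_increment_le (h : Trajectory bA bB lamA lamB r σ τ J N u y μ g z)
    (hpos : ∀ j, 0 ≤ lamB j) (hmono : Monotone lamB) (hlam : Tendsto lamB atTop atTop)
    (hσ : 0 < σ) (hτ : 0 ≤ τ) {P : Hs Om → ℝ} {L : ℝ} (hL : 0 ≤ L)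
    (hP : ∀ v w, |P v - P w - ⟪N v, v - w⟫| ≤ L * ‖v - w‖ ^ 2) :
    ∃ C : ℝ, 0 ≤ C ∧ ∃ good : ℝ → Prop, (∀ᵐ t ∂(volume.restrict (Ioi (0:ℝ))), good t) ∧
      ∀ s t, 0 < s → s < t → good s → good t →
        energy lamB bB σ J P (y t) - energy lamB bB σ J P (y s)
          ≤ ⟪u t, y t - y s⟫ - (∫ p in s..t, ⟪g t, g p⟫) - τ⁻¹ * (∫ p in s..t, ⟪z t, z p⟫)
            + C * ((t - s) * ∫ p in s..t, ‖g p‖ ^ 2) := by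
  obtain ⟨C, hC, hEhr⟩ := h.increment_sq_le hpos hmono hlam hσ
    (ε := 1 / (2 * (L + 1))) (by positivity)
  refine ⟨L * C, by positivity, _, (h.ineq.and (h.dom_mu.and (h.dom_y.and (h.J_lt_top.and
    (h.ae_inner_z hτ))))), ?_⟩
  rintro s t hs hst ⟨-, -, hys, hJs, -⟩ ⟨hin, hmu, hyt, -, hz⟩
  have h1 := hin (y s) hys hJs
  have h2 := hz s t hs.le hst.le
  have h3 := h.weak _ hmu s t hs.le hst.le
  simp only [← h.g_eq] at h3
  rw [real_inner_comm] at h3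
  simp only [real_inner_comm (g t)] at h3
  have hw := hEhr s t hs.le hst.le (hyt.sub bB hys)
  rw [fracPow_sub bB hyt hys] at hw
  have h4 := (abs_le.1 (hP (y t) (y s))).2
  rw [inner_sub_left] at h1
  set a := fracPow lamB bB σ (y t)
  set b := fracPow lamB bB σ (y s)
  have h5 : ⟪a, a - b⟫ = ‖a‖ ^ 2 / 2 - ‖b‖ ^ 2 / 2 + ‖a - b‖ ^ 2 / 2 := by
    rw [norm_sub_sq_real, inner_sub_right, real_inner_self_eq_norm_sq]
    ring
  have h6 : L * ‖y t - y s‖ ^ 2 ≤ ‖a - b‖ ^ 2 / 2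
      + L * C * ((t - s) * ∫ p in s..t, ‖g p‖ ^ 2) := by
    have := mul_le_mul_of_nonneg_left hw hL
    have e : L * (1 / (2 * (L + 1)) * ‖a - b‖ ^ 2) ≤ ‖a - b‖ ^ 2 / 2 := by
      have : L * (1 / (2 * (L + 1)) * ‖a - b‖ ^ 2) = ‖a - b‖ ^ 2 / 2 * (L / (L + 1)) := by
        field_simp
      rw [this]
      refine mul_le_of_le_one_right (by positivity) ?_
      rw [div_le_one (by positivity)]
      linarith
    linarith
  unfold energy
  linarith

lemma energy_inequality (h : Trajectory bA bB lamA lamB r σ τ J N u y μ g z)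
    (hpos : ∀ j, 0 ≤ lamB j) (hmono : Monotone lamB) (hlam : Tendsto lamB atTop atTop)
    (hσ : 0 < σ) (hτ : 0 ≤ τ) {P : Hs Om → ℝ} {L : ℝ} (hL : 0 ≤ L) (hPc : Continuous P)
    (hP : ∀ v w, |P v - P w - ⟪N v, v - w⟫| ≤ L * ‖v - w‖ ^ 2)
    (hu : IntegrableOn u' (Ioi (0:ℝ)))
    (hu2 : ∀ t : ℝ, 0 ≤ t → u t = u 0 + ∫ s in (0:ℝ)..t, u' s)
    {T M : ℝ} (hM : ∀ t ∈ Ioo 0 T, ‖y t‖ ≤ M) :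
    ∀ᵐ a : ℝ, ∀ᵐ b : ℝ, 0 < a → a < b → b < T →
      (energy lamB bB σ J P (y b) - ⟪u b, y b⟫) - (energy lamB bB σ J P (y a) - ⟪u a, y a⟫)
        + ∫ p in a..b, (‖g p‖ ^ 2 + τ⁻¹ * ‖z p‖ ^ 2) ≤ M * ∫ p in a..b, ‖u' p‖ := by
  rcases le_or_gt T 0 with hT | hT
  · exact Eventually.of_forall fun a => Eventually.of_forall fun b h1 h2 h3 => by linarith
  have hM0 : 0 ≤ M := (norm_nonneg _).trans (hM (T / 2) ⟨by linarith, by linarith⟩)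
  have subI : Ioo 0 T ⊆ Ioi (0:ℝ) := fun p hp => hp.1
  have subC : Ioo 0 T ⊆ Ioc 0 T := Ioo_subset_Ioc_self
  set c := √τ⁻¹ with hc
  have hcc : c * c = τ⁻¹ := Real.mul_self_sqrt (inv_nonneg.2 hτ)
  set G : ℝ → WithLp 2 (Hs Om × Hs Om) := fun t => WithLp.toLp 2 (g t, c • z t) with hG
  set E : ℝ → ℝ := fun t => energy lamB bB σ J P (y t) - ⟪u t, y t⟫ with hE
  have Ginner : ∀ s t, ⟪G s, G t⟫ = ⟪g s, g t⟫ + τ⁻¹ * ⟪z s, z t⟫ := fun s t => by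
    simp only [hG, WithLp.prod_inner_apply, real_inner_smul_left, real_inner_smul_right]
    rw [← hcc]; ring
  have Gnorm : ∀ t, ‖G t‖ ^ 2 = ‖g t‖ ^ 2 + τ⁻¹ * ‖z t‖ ^ 2 := fun t => by
    rw [← real_inner_self_eq_norm_sq, Ginner, real_inner_self_eq_norm_sq,
      real_inner_self_eq_norm_sq]
  have iG2 : IntegrableOn (fun t => ‖G t‖ ^ 2) (Ioo 0 T) := by
    simp only [Gnorm]
    exact (((h.sq_g T hT).mono_set subC).add (((h.sq_z T hT).mono_set subC).const_mul _))
  have mG : AEStronglyMeasurable G (volume.restrict (Ioo 0 T)) :=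
    (WithLp.prod_continuous_toLp 2 _ _).comp_aestronglyMeasurable
      ((h.meas_g.mono_set subI).prodMk ((h.meas_z.mono_set subI).const_smul c))
  have iG : IntegrableOn G (Ioo 0 T) := integrable_of_sq mG iG2
  have mu : AEStronglyMeasurable u (volume.restrict (Ioo 0 T)) :=
    ((continuousOn_of_primitive hu hu2).mono fun p hp => hp.1.le).aestronglyMeasurable
      measurableSet_Ioo
  have my := h.meas_y.mono_set subI
  have bd : ∀ {f : ℝ → ℝ} {C : ℝ}, AEStronglyMeasurable f (volume.restrict (Ioo 0 T)) →
      (∀ᵐ t ∂(volume.restrict (Ioo 0 T)), |f t| ≤ C) → IntegrableOn f (Ioo 0 T) :=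
    fun hf hC => Integrable.of_bound hf _ hC
  have iE : IntegrableOn E (Ioo 0 T) := by
    have i1 : IntegrableOn (fun t => ‖fracPow lamB bB σ (y t)‖ ^ 2 / 2) (Ioo 0 T) := by
      obtain ⟨C, hC⟩ := h.bdd_y T hT
      refine bd (C := C) (((aestronglyMeasurable_fracPow bB my
        (ae_restrict_of_ae_restrict_of_subset subI h.dom_y)).norm.pow 2).mul_const _) ?_
      filter_upwards [ae_restrict_of_ae_restrict_of_subset subC hC] with t ht
      rw [abs_of_nonneg (by positivity)]
      have h2 := sq_nonneg ‖y t‖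
      have h3 := sq_nonneg ‖fracPow lamB bB σ (y t)‖
      unfold gnormSq at ht
      linarith
    have i2 : IntegrableOn (fun t => P (y t)) (Ioo 0 T) := by
      refine bd (C := |P 0| + ‖N 0‖ * M + L * M ^ 2) (hPc.comp_aestronglyMeasurable my) ?_
      filter_upwards [ae_restrict_mem measurableSet_Ioo] with t ht
      have h1 := abs_le.1 (hP 0 (y t))
      have h2 := abs_le.1 ((abs_real_inner_le_norm (N 0) (0 - y t)))
      have h4 := hM t ht
      rw [zero_sub, norm_neg] at *
      have h5 : ‖N 0‖ * ‖y t‖ ≤ ‖N 0‖ * M := by gcongr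
      have h6 : L * ‖y t‖ ^ 2 ≤ L * M ^ 2 := by gcongr
      have h7 := abs_le.1 (le_refl |P 0|)
      rw [abs_le]
      constructor <;> linarith
    have i3 : IntegrableOn (fun t => ⟪u t, y t⟫) (Ioo 0 T) := by
      refine bd (C := (‖u 0‖ + ∫ p in Ioi (0:ℝ), ‖u' p‖) * M) (mu.inner my) ?_
      filter_upwards [ae_restrict_mem measurableSet_Ioo] with t ht
      refine (abs_real_inner_le_norm _ _).trans ?_
      have h1 := norm_le_of_primitive hu hu2 ht.1.le
      have h2 := (norm_nonneg _).trans h1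
      have h3 := hM t ht
      gcongr
    exact ((i1.add ((h.int_J T hT).mono_set subC)).add i2).sub i3
  have iu : IntegrableOn (fun p => ‖u' p‖) (Ioo 0 T) := (hu.mono_set subI).norm
  obtain ⟨C, hC, good, hgood, hinc⟩ :=
    h.exists_energy_increment_le hpos hmono hlam hσ hτ hL hP
  have memI : ∀ {s t p : ℝ}, 0 < s → t < T → p ∈ Ioc s t → p ∈ Ioo 0 T := fun hs ht hp =>
    ⟨hs.trans hp.1, hp.2.trans_lt ht⟩
  have cong : ∀ {f f' : ℝ → ℝ} {s t : ℝ}, 0 < s → s < t → t < T →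
      (∀ p ∈ Ioo 0 T, f p = f' p) → ∫ p in s..t, f p = ∫ p in s..t, f' p := by
    intro f f' s t hs hst ht hf
    refine intervalIntegral.integral_congr_ae (Eventually.of_forall fun p hp => hf p ?_)
    rw [uIoc_of_le hst.le] at hp
    exact memI hs ht hp
  have key := energy_inequality_of_increments (G := (Ioo 0 T).indicator G)
    (E := (Ioo 0 T).indicator E) (k := (Ioo 0 T).indicator fun p => ‖u' p‖) (T := T) (M := M)
    (C := C) (P := good)
    (iG.integrable_indicator measurableSet_Ioo).locallyIntegrable
    (by
      refine (iG2.integrable_indicator measurableSet_Ioo).locallyIntegrable.congr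
        (Eventually.of_forall fun t => ?_)
      by_cases ht : t ∈ Ioo 0 T <;> simp [ht])
    (iE.integrable_indicator measurableSet_Ioo).locallyIntegrable
    (iu.integrable_indicator measurableSet_Ioo).locallyIntegrable
    (by
      filter_upwards [(ae_restrict_iff' measurableSet_Ioi).1 hgood] with t ht htT
      exact ht htT.1)
    (by
      intro s t hs hst ht gs gt
      have hsI : s ∈ Ioo 0 T := ⟨hs, hst.trans ht⟩
      have htI : t ∈ Ioo 0 T := ⟨hs.trans hst, ht⟩
      rw [indicator_of_mem hsI, indicator_of_mem htI, indicator_of_mem htI,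
        cong (f := fun p => ⟪G t, (Ioo 0 T).indicator G p⟫)
          (f' := fun p => ⟪g t, g p⟫ + τ⁻¹ * ⟪z t, z p⟫) hs hst ht
          (fun p hp => by rw [indicator_of_mem hp, Ginner]),
        cong (f := (Ioo 0 T).indicator fun p => ‖u' p‖) (f' := fun p => ‖u' p‖) hs hst ht (fun p hp => by rw [indicator_of_mem hp]),
        cong (f := fun p => ‖(Ioo 0 T).indicator G p‖ ^ 2)
          (f' := fun p => ‖g p‖ ^ 2 + τ⁻¹ * ‖z p‖ ^ 2) hs hst ht
          (fun p hp => by rw [indicator_of_mem hp, Gnorm])]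
      have ig := h.intervalIntegrable_g hs.le hst.le
      have iz := h.intervalIntegrable_z hs.le hst.le
      have ig2 := h.intervalIntegrable_sq_g hs.le hst.le
      have iz2 := h.intervalIntegrable_sq_z hs.le hst.le
      rw [intervalIntegral.integral_add (intervalIntegrable_const_inner ig _)
        ((intervalIntegrable_const_inner iz _).const_mul _),
        intervalIntegral.integral_const_mul,
        intervalIntegral.integral_add ig2 (iz2.const_mul _)]
      have h1 := hinc s t hs hst gs gt
      have h2 : 0 ≤ ∫ p in s..t, τ⁻¹ * ‖z p‖ ^ 2 :=
        intervalIntegral.integral_nonneg hst.le fun p _ => by positivity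
      have h3 : -⟪u t - u s, y s⟫ ≤ M * ∫ p in s..t, ‖u' p‖ := by
        refine (neg_le_abs _).trans ((abs_real_inner_le_norm _ _).trans ?_)
        rw [mul_comm]
        have := norm_sub_le_of_primitive hu hu2 hs.le hst.le
        have := hM s hsI
        gcongr
      have h4 : 0 ≤ C * ((t - s) * ∫ p in s..t, τ⁻¹ * ‖z p‖ ^ 2) := by
        have := sub_pos.2 hst
        positivity
      rw [inner_sub_left] at h3
      rw [inner_sub_right] at h1
      simp only [hE]
      rw [mul_add, mul_add]
      linarith)
  filter_upwards [key] with a ha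
  filter_upwards [ha] with b hb h0a hab hbT
  have haI : a ∈ Ioo 0 T := ⟨h0a, hab.trans hbT⟩
  have hbI : b ∈ Ioo 0 T := ⟨h0a.trans hab, hbT⟩
  have := hb h0a hab hbT
  rw [indicator_of_mem haI, indicator_of_mem hbI,
    cong (f := (Ioo 0 T).indicator fun p => ‖u' p‖) (f' := fun p => ‖u' p‖) h0a hab hbT (fun p hp => by rw [indicator_of_mem hp]),
    cong (f := fun p => ‖(Ioo 0 T).indicator G p‖ ^ 2)
      (f' := fun p => ‖g p‖ ^ 2 + τ⁻¹ * ‖z p‖ ^ 2) h0a hab hbT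
      (fun p hp => by rw [indicator_of_mem hp, Gnorm])] at this
  exact this

end Trajectory

end Trajectories

section Trajectories

variable {Om : Set E3} {bA bB : HilbertBasis ℕ ℝ (Hs Om)} {lamA lamB : ℕ → ℝ} {r σ τ : ℝ}
  {J : Hs Om → ℝ≥0∞} {N : Hs Om → Hs Om} {u u' y μ g z : ℝ → Hs Om}

namespace Trajectory

lemma exists_norm_le (h : Trajectory bA bB lamA lamB r σ τ J N u y μ g z) (T : ℝ) :
    ∃ M, ∀ t ∈ Ioo 0 T, ‖y t‖ ≤ M := by
  rcases le_or_gt T 0 with hT | hT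
  · exact ⟨0, fun t ht => absurd (ht.1.trans ht.2) hT.not_gt⟩
  obtain ⟨C, hC⟩ := h.bdd_y T hT
  refine ⟨√C, fun t ht => Real.le_sqrt_of_sq_le ?_⟩
  refine (le_add_of_nonneg_right (sq_nonneg _)).trans (h.bound_of_ae (C := C) le_rfl ?_ ht).2
  filter_upwards [(ae_restrict_iff' measurableSet_Ioc).1 hC] with s hs hsI
  exact hs ⟨hsI.1, hsI.2.le⟩

/-- Bounds that are uniform in time. -/
lemma exists_global_bound (h : Trajectory bA bB lamA lamB r σ τ J N u y μ g z)
    (hpos : ∀ j, 0 ≤ lamB j) (hmono : Monotone lamB) (hlam : Tendsto lamB atTop atTop)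
    (hσ : 0 < σ) (hτ : 0 ≤ τ) {P : Hs Om → ℝ} {L : ℝ} (hL : 0 ≤ L) (hPc : Continuous P)
    (hP : ∀ v w, |P v - P w - ⟪N v, v - w⟫| ≤ L * ‖v - w‖ ^ 2)
    (hu : IntegrableOn u' (Ioi (0:ℝ)))
    (hu2 : ∀ t : ℝ, 0 ≤ t → u t = u 0 + ∫ s in (0:ℝ)..t, u' s)
    {α K : ℝ} (hα : 0 < α) (hK : ∀ v, J v < ⊤ → α * ‖v‖ ^ 2 - K ≤ P v + (J v).toReal) :
    ∃ a, 0 < a ∧ (∃ C, ∀ t, a < t → inDom lamB bB σ (y t) ∧ gnormSq lamB bB σ (y t) ≤ C) ∧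
      IntegrableOn (fun t => ‖g t‖ ^ 2 + τ⁻¹ * ‖z t‖ ^ 2) (Ioi a) := by
  set E : ℝ → ℝ := fun t => energy lamB bB σ J P (y t) - ⟪u t, y t⟫ with hE
  set F : ℝ → ℝ := fun t => ‖g t‖ ^ 2 + τ⁻¹ * ‖z t‖ ^ 2 with hF
  have hF0 : ∀ t, 0 ≤ F t := fun t => by positivity
  set S : ℕ → ℝ := fun n => sSup ((fun t => ‖y t‖) '' Ioo 0 ((n:ℝ) + 1)) with hS
  have hyS : ∀ n : ℕ, ∀ t ∈ Ioo (0:ℝ) (n + 1), ‖y t‖ ≤ S n := fun n t ht => by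
    obtain ⟨M, hM⟩ := h.exists_norm_le (n + 1)
    exact le_csSup ⟨M, by rintro _ ⟨s, hs, rfl⟩; exact hM s hs⟩ ⟨t, ht, rfl⟩
  have hSle : ∀ n : ℕ, ∀ R, (∀ t ∈ Ioo (0:ℝ) (n + 1), ‖y t‖ ≤ R) → S n ≤ R := fun n R hR => by
    have hne : (Ioo (0:ℝ) (n + 1)).Nonempty := nonempty_Ioo.2 (by positivity)
    exact csSup_le (hne.image _) (by rintro _ ⟨s, hs, rfl⟩; exact hR s hs)
  have hS0 : ∀ n, 0 ≤ S n := fun n => by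
    have : (0:ℝ) < n + 1 := by positivity
    exact (norm_nonneg _).trans (hyS n (((n:ℝ) + 1) / 2) ⟨by linarith, by linarith⟩)
  set D := ∫ p in Ioi (0:ℝ), ‖u' p‖ with hD
  have hD0 : 0 ≤ D := integral_nonneg fun _ => norm_nonneg _
  set U := ‖u 0‖ + D with hU
  have hae : ∀ᵐ a : ℝ, ∀ n : ℕ, ∀ᵐ b : ℝ, 0 < a → a < b → b < n + 1 →
      E b - E a + ∫ p in a..b, F p ≤ S n * ∫ p in a..b, ‖u' p‖ :=
    ae_all_iff.2 fun n => h.energy_inequality hpos hmono hlam hσ hτ hL hPc hP hu hu2 (hyS n)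
  obtain ⟨a, ⟨ha0, ha1⟩, ha⟩ : ∃ a ∈ Ioo (0:ℝ) 1, ∀ n : ℕ, ∀ᵐ b : ℝ, 0 < a → a < b → b < n + 1 →
      E b - E a + ∫ p in a..b, F p ≤ S n * ∫ p in a..b, ‖u' p‖ := by
    obtain ⟨s, -, hs⟩ := exists_seq_of_ae_Ioo (p := 0) (q := 1) (t := 1 / 2)
      (hae.mono fun a ha _ => ha) (by norm_num)
    exact ⟨s 0, (hs 0).1, (hs 0).2⟩
  set κ := min (1 / 2) (α / 2) with hκ
  have hκ0 : 0 < κ := by positivity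
  have hlow : ∀ᵐ b : ℝ, 0 < b → κ * gnormSq lamB bB σ (y b) - (K + U ^ 2 / (2 * α)) ≤ E b := by
    filter_upwards [(ae_restrict_iff' measurableSet_Ioi).1 h.J_lt_top] with b hb hb0
    have h1 := hK _ (hb hb0)
    have h2 : ⟪u b, y b⟫ ≤ U * ‖y b‖ := (real_inner_le_norm _ _).trans (by
      gcongr; exact norm_le_of_primitive hu hu2 hb0.le)
    have h3 : U * ‖y b‖ ≤ α / 2 * ‖y b‖ ^ 2 + U ^ 2 / (2 * α) := by
      have : α / 2 * ‖y b‖ ^ 2 + U ^ 2 / (2 * α) - U * ‖y b‖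
          = (α * ‖y b‖ - U) ^ 2 / (2 * α) := by field_simp; ring
      have : 0 ≤ (α * ‖y b‖ - U) ^ 2 / (2 * α) := by positivity
      linarith
    have h4 : κ * ‖y b‖ ^ 2 ≤ α / 2 * ‖y b‖ ^ 2 := by gcongr; exact min_le_right _ _
    have h5 : κ * ‖fracPow lamB bB σ (y b)‖ ^ 2 ≤ 1 / 2 * ‖fracPow lamB bB σ (y b)‖ ^ 2 := by
      gcongr; exact min_le_left _ _
    simp only [hE, energy, gnormSq]
    linarith
  set Y := E a + (K + U ^ 2 / (2 * α)) with hY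
  have hmain : ∀ n : ℕ, ∀ᵐ b : ℝ, b ∈ Ioo a (n + 1) →
      κ * gnormSq lamB bB σ (y b) + ∫ p in a..b, F p ≤ Y + S n * D := by
    intro n
    filter_upwards [ha n, hlow] with b h1 h2 hb
    have h3 := h1 ha0 hb.1 hb.2
    have h4 := h2 (ha0.trans hb.1)
    have h5 : S n * ∫ p in a..b, ‖u' p‖ ≤ S n * D :=
      mul_le_mul_of_nonneg_left (integral_norm_le_of_integrableOn_Ioi hu ha0.le hb.1.le) (hS0 n)
    linarith
  have hbound : ∀ n : ℕ, ∀ t ∈ Ioo a ((n:ℝ) + 1),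
      inDom lamB bB σ (y t) ∧ gnormSq lamB bB σ (y t) ≤ (Y + S n * D) / κ := by
    intro n t ht
    refine h.bound_of_ae ha0.le ?_ ht
    filter_upwards [hmain n] with b hb hbI
    have h2 : 0 ≤ ∫ p in a..b, F p :=
      intervalIntegral.integral_nonneg hbI.1.le fun p _ => hF0 p
    rw [le_div_iff₀ hκ0]
    linarith [hb hbI]
  set A := S 0 ^ 2 + |Y| / κ with hA
  set B := D / κ with hB
  have hA0 : 0 ≤ A := by positivity
  have hB0 : 0 ≤ B := by positivity
  have hSR : ∀ n, S n ≤ A + B + 1 := by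
    intro n
    have hsq : S n ≤ √(A + B * S n) := by
      refine hSle n _ fun t ht => Real.le_sqrt_of_sq_le ?_
      have hBS : 0 ≤ B * S n := mul_nonneg hB0 (hS0 n)
      rcases lt_or_ge t 1 with h1 | h1
      · have h2 := hyS 0 t ⟨ht.1, by simpa using h1⟩
        have h3 : ‖y t‖ ^ 2 ≤ S 0 ^ 2 := by gcongr
        have h4 : 0 ≤ |Y| / κ := by positivity
        linarith
      · have h2 := (hbound n t ⟨ha1.trans_le h1, ht.2⟩).2
        have h3 : ‖y t‖ ^ 2 ≤ gnormSq lamB bB σ (y t) := le_add_of_nonneg_right (sq_nonneg _)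
        have h4 : (Y + S n * D) / κ ≤ |Y| / κ + B * S n := by
          have : (Y + S n * D) / κ = Y / κ + B * S n := by rw [hB]; field_simp
          rw [this]
          gcongr
          exact le_abs_self Y
        have h5 := sq_nonneg (S 0)
        linarith
    have h2 := (Real.le_sqrt (hS0 n) (by have := hS0 n; positivity)).1 hsq
    by_contra! hlt
    nlinarith [hS0 n, mul_nonneg hA0 (hS0 n), mul_nonneg hB0 (hS0 n)]
  set R := A + B + 1 with hR
  have hSD : ∀ n, Y + S n * D ≤ Y + R * D := fun n => by
    have := mul_le_mul_of_nonneg_right (hSR n) hD0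
    linarith
  refine ⟨a, ha0, ⟨(Y + R * D) / κ, fun t ht => ?_⟩, ?_⟩
  · obtain ⟨n, hn⟩ := exists_nat_gt t
    obtain ⟨h1, h2⟩ := hbound n t ⟨ht, hn.trans (by linarith)⟩
    exact ⟨h1, h2.trans (by have := hSD n; gcongr)⟩
  · have hex : ∀ n : ℕ, ∃ b, (n:ℝ) + a < b ∧ ∫ p in a..b, F p ≤ Y + R * D := by
      intro n
      obtain ⟨s, -, hs⟩ := exists_seq_of_ae_Ioo (p := n + a) (q := (n + 1 : ℕ) + a)
        (t := n + a + 1 / 2) ((hmain (n + 1)).mono fun b hb _ => hb)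
        ⟨by linarith, by push_cast; linarith⟩
      obtain ⟨⟨h1, h2⟩, h3⟩ := hs 0
      have hn : (0:ℝ) ≤ n := n.cast_nonneg
      have h4 := h3 ⟨by linarith, by linarith⟩
      have h5 : 0 ≤ κ * gnormSq lamB bB σ (y (s 0)) :=
        mul_nonneg hκ0.le (add_nonneg (sq_nonneg _) (sq_nonneg _))
      exact ⟨s 0, h1, by linarith [hSD (n + 1)]⟩
    choose b hb1 hb2 using hex
    refine integrableOn_Ioi_of_intervalIntegral_norm_bounded (l := atTop) (b := b) (Y + R * D) a
      (fun n => ?_) ?_ (Eventually.of_forall fun n => ?_)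
    · have hab : a ≤ b n := by
        have hn : (0:ℝ) ≤ n := n.cast_nonneg
        linarith [hb1 n]
      exact (intervalIntegrable_iff_integrableOn_Ioc_of_le hab).1
        ((h.intervalIntegrable_sq_g ha0.le hab).add
          ((h.intervalIntegrable_sq_z ha0.le hab).const_mul _))
    · exact tendsto_atTop_mono (fun n => by linarith [hb1 n]) tendsto_natCast_atTop_atTop
    · simpa only [Real.norm_of_nonneg (hF0 _)] using hb2 n

end Trajectory

end Trajectories

lemma tendsto_integral_unit_interval {F : ℝ → ℝ} {a : ℝ} (hF : IntegrableOn F (Ioi a)) {t : ℕ → ℝ}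
    (ht : ∀ n, a < t n) (hlim : Tendsto t atTop atTop) :
    Tendsto (fun n => ∫ p in (t n)..(t n + 1), F p) atTop (𝓝 0) := by
  have h1 := intervalIntegral_tendsto_integral_Ioi a hF hlim
  have h2 := intervalIntegral_tendsto_integral_Ioi a hF (tendsto_atTop_add_const_right _ 1 hlim)
  have ii : ∀ b, a ≤ b → IntervalIntegrable F volume a b := fun b hb => by
    rw [intervalIntegrable_iff_integrableOn_Ioc_of_le hb]
    exact hF.mono_set Ioc_subset_Ioi_self
  have h3 := h2.sub h1
  rw [sub_self] at h3
  refine h3.congr fun n => ?_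
  exact intervalIntegral.integral_interval_sub_left (ii _ (by linarith [ht n])) (ii _ (ht n).le)

/-- An integrable function is small at suitable points of the unit intervals going to infinity. -/
lemma exists_seq_tendsto_zero {F : ℝ → ℝ} {a : ℝ} (hF : IntegrableOn F (Ioi a)) (hF0 : ∀ t, 0 ≤ F t)
    {P : ℝ → Prop} (hP : ∀ᵐ t ∂(volume.restrict (Ioi a)), P t) {t : ℕ → ℝ} (ht : ∀ n, a < t n)
    (hlim : Tendsto t atTop atTop) :
    ∃ s : ℕ → ℝ, (∀ n, s n ∈ Ioo (t n) (t n + 1) ∧ P (s n)) ∧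
      Tendsto (fun n => F (s n)) atTop (𝓝 0) := by
  have key : ∀ n, ∃ s, (s ∈ Ioo (t n) (t n + 1) ∧ P s) ∧
      F s ≤ ∫ p in (t n)..(t n + 1), F p := by
    intro n
    have hsub : Ioo (t n) (t n + 1) ⊆ Ioi a := fun p hp => (ht n).trans hp.1
    by_contra! hcon
    have hae : ∀ᵐ s ∂(volume.restrict (Ioo (t n) (t n + 1))),
        ∫ p in (t n)..(t n + 1), F p < F s := by
      filter_upwards [ae_restrict_of_ae_restrict_of_subset hsub hP,
        ae_restrict_mem measurableSet_Ioo] with s h1 h2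
      exact hcon s ⟨h2, h1⟩
    have : IsProbabilityMeasure (volume.restrict (Ioo (t n) (t n + 1))) := ⟨by simp⟩
    obtain ⟨s, hs1, hs2⟩ := exists_notMem_null_le_integral (hF.mono_set hsub) (ae_iff.1 hae)
    rw [← integral_Ioc_eq_integral_Ioo, ← intervalIntegral.integral_of_le (by linarith)] at hs2
    exact hs1 (not_lt.2 hs2)
  choose s hs1 hs2 using key
  exact ⟨s, hs1, squeeze_zero (fun n => hF0 _) hs2 (tendsto_integral_unit_interval hF ht hlim)⟩

/-- Passage to the limit in a sequence of variational inequalities with unbounded multipliers. -/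
lemma exists_multiplier {X : Type*} [NormedAddCommGroup X] [InnerProductSpace ℝ X]
    {J : X → ℝ≥0∞} (hJ : LowerSemicontinuous J) {x : ℕ → X} {w : X} (hx : Tendsto x atTop (𝓝 w))
    (hxJ : ∀ n, J (x n) < ⊤) {e y : X} (he : ∀ n, ⟪e, x n⟫ = ⟪e, y⟫) {m : ℕ → ℝ}
    {E : ℕ → X → ℝ} {E' : X → ℝ} {D : Set X}
    (hE : ∀ v ∈ D, Tendsto (fun n => E n v) atTop (𝓝 (E' v)))
    (hle : ∀ n, ∀ v ∈ D, (J (x n)).toReal ≤ m n * ⟪e, x n - v⟫ + E n v)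
    {v₁ v₂ : X} (hv₁ : v₁ ∈ D) (hv₂ : v₂ ∈ D) (h₁ : ⟪e, y - v₁⟫ < 0) (h₂ : 0 < ⟪e, y - v₂⟫) :
    ∃ m' : ℝ, J w < ⊤ ∧ ∀ v ∈ D, (J w).toReal ≤ m' * ⟪e, w - v⟫ + E' v := by
  have he' : ∀ n v, ⟪e, x n - v⟫ = ⟪e, y - v⟫ := fun n v => by
    rw [inner_sub_right, inner_sub_right, he]
  obtain ⟨K₁, hK₁⟩ := (hE _ hv₁).bddAbove_range
  obtain ⟨K₂, hK₂⟩ := (hE _ hv₂).bddAbove_range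
  have hm : ∀ n, m n ∈ Icc (-(K₂ / ⟪e, y - v₂⟫)) (K₁ / -⟪e, y - v₁⟫) := by
    intro n
    have a₁ := hle n _ hv₁
    have a₂ := hle n _ hv₂
    have b₁ : E n v₁ ≤ K₁ := hK₁ ⟨n, rfl⟩
    have b₂ : E n v₂ ≤ K₂ := hK₂ ⟨n, rfl⟩
    have c : 0 ≤ (J (x n)).toReal := toReal_nonneg
    rw [he'] at a₁ a₂
    constructor
    · rw [neg_le, le_div_iff₀ h₂]
      linarith
    · rw [le_div_iff₀ (neg_pos.2 h₁)]
      linarith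
  obtain ⟨m', -, φ, hφ, hlim⟩ := tendsto_subseq_of_bounded (Metric.isBounded_Icc _ _) hm
  have hR : ∀ v ∈ D, Tendsto (fun n => m (φ n) * ⟪e, x (φ n) - v⟫ + E (φ n) v) atTop
      (𝓝 (m' * ⟪e, w - v⟫ + E' v)) := fun v hv =>
    (hlim.mul (tendsto_const_nhds.inner ((hx.comp hφ.tendsto_atTop).sub_const v))).add
      ((hE v hv).comp hφ.tendsto_atTop)
  have hJR : ∀ v ∈ D, J w ≤ ENNReal.ofReal (m' * ⟪e, w - v⟫ + E' v) := by
    intro v hv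
    refine le_of_forall_lt fun c hc => ?_
    obtain ⟨c', hcc', hc'⟩ := exists_between hc
    refine hcc'.trans_le (ge_of_tendsto (ENNReal.tendsto_ofReal (hR v hv)) ?_)
    filter_upwards [(hx.comp hφ.tendsto_atTop).eventually (hJ w c' hc')] with n hn
    exact hn.le.trans ((ENNReal.le_ofReal_iff_toReal_le (hxJ _).ne
      (toReal_nonneg.trans (hle _ v hv))).2 (hle _ v hv))
  refine ⟨m', (hJR v₁ hv₁).trans_lt ofReal_lt_top, fun v hv => ?_⟩
  have h0 : 0 ≤ m' * ⟪e, w - v⟫ + E' v :=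
    ge_of_tendsto' (hR v hv) fun n => toReal_nonneg.trans (hle _ v hv)
  exact toReal_le_of_le_ofReal h0 (hJR v hv)

section Trajectories

variable {Om : Set E3} {bA bB : HilbertBasis ℕ ℝ (Hs Om)} {lamA lamB : ℕ → ℝ} {r σ τ : ℝ}
  {J : Hs Om → ℝ≥0∞} {N : Hs Om → Hs Om} {u u' y μ g z : ℝ → Hs Om}

lemma fracPow_basis (b : HilbertBasis ℕ ℝ (Hs Om)) (lam : ℕ → ℝ) (ρ : ℝ) (j : ℕ) :
    fracPow lam b ρ (b j) = (lam j ^ ρ) • b j := by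
  refine eq_of_inner_basis_eq b fun i => ?_
  rw [inner_fracPow_basis b (inDom_basis b j), real_inner_smul_left,
    orthonormal_iff_ite.1 b.orthonormal]
  split_ifs with hij
  · rw [hij]
  · simp

/-- A Poincaré type inequality. -/
lemma norm_sub_sq_le_fracPow (b : HilbertBasis ℕ ℝ (Hs Om)) {lam : ℕ → ℝ} {ρ : ℝ}
    (hpos : ∀ j, 0 ≤ lam j) (hmono : Monotone lam) (hρ : 0 < ρ) (h1 : 0 < lam 1) {v : Hs Om}
    (hv : inDom lam b ρ v) :
    ‖v - ⟪v, b 0⟫ • b 0‖ ^ 2 ≤ ((lam 1 ^ ρ) ^ 2)⁻¹ * ‖fracPow lam b ρ v‖ ^ 2 := by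
  have h := norm_sq_le_sum_add_fracPow b hpos hmono hρ hv 1 h1
  rw [Finset.sum_range_one] at h
  rw [norm_sub_sq_real, real_inner_smul_right, norm_smul, b.orthonormal.1 0, mul_one,
    Real.norm_eq_abs, sq_abs]
  linarith

lemma tendsto_inner_of_innerFrac (b : HilbertBasis ℕ ℝ (Hs Om)) {lam : ℕ → ℝ} {ρ : ℝ}
    {v : ℕ → Hs Om} {w : Hs Om} (hv : ∀ n, inDom lam b ρ (v n)) (hw : inDom lam b ρ w)
    (h : ∀ φ, inDom lam b ρ φ →
      Tendsto (fun n => innerFrac lam b ρ (v n) φ) atTop (𝓝 (innerFrac lam b ρ w φ))) (j : ℕ) :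
    Tendsto (fun n => ⟪v n, b j⟫) atTop (𝓝 ⟪w, b j⟫) := by
  have e : ∀ x, inDom lam b ρ x → innerFrac lam b ρ x (b j) = (1 + (lam j ^ ρ) ^ 2) * ⟪x, b j⟫ := by
    intro x hx
    rw [innerFrac, fracPow_basis, real_inner_smul_right, inner_fracPow_basis b hx]
    ring
  have hpos : 0 < 1 + (lam j ^ ρ) ^ 2 := by positivity
  have h1 := (h _ (inDom_basis b j)).const_mul (1 + (lam j ^ ρ) ^ 2)⁻¹
  rw [e w hw, inv_mul_cancel_left₀ hpos.ne'] at h1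
  refine h1.congr fun n => ?_
  rw [e _ (hv n), inv_mul_cancel_left₀ hpos.ne']

end Trajectories

section Trajectories

variable {Om : Set E3} {bA bB : HilbertBasis ℕ ℝ (Hs Om)} {lamA lamB : ℕ → ℝ} {r σ τ : ℝ}
  {J : Hs Om → ℝ≥0∞} {N : Hs Om → Hs Om} {u u' y μ g z : ℝ → Hs Om}

lemma tendsto_zero_of_sq_le {X : Type*} [NormedAddCommGroup X] {f : ℕ → X} {F : ℕ → ℝ}
    (hF : Tendsto F atTop (𝓝 0)) (h : ∀ n, ‖f n‖ ^ 2 ≤ F n) : Tendsto f atTop (𝓝 0) := by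
  rw [tendsto_zero_iff_norm_tendsto_zero]
  have := (squeeze_zero (fun n => sq_nonneg ‖f n‖) h hF).sqrt
  simpa [Real.sqrt_sq] using this

/-- Weak convergence of the fractional powers. -/
lemma tendsto_inner_fracPow (b : HilbertBasis ℕ ℝ (Hs Om)) {lam : ℕ → ℝ} {ρ C : ℝ}
    {v : ℕ → Hs Om} {w : Hs Om}
    (hv : ∀ n, inDom lam b ρ (v n)) (hC : ∀ n, gnormSq lam b ρ (v n) ≤ C)
    (hlim : ∀ j, Tendsto (fun n => ⟪v n, b j⟫) atTop (𝓝 ⟪w, b j⟫)) (k : Hs Om) :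
    Tendsto (fun n => ⟪fracPow lam b ρ (v n), k⟫) atTop (𝓝 ⟪fracPow lam b ρ w, k⟫) := by
  have hw := (inDom_of_tendsto b hv hC hlim).1
  have hbd : ∀ n, ‖fracPow lam b ρ (v n) - fracPow lam b ρ w‖ ≤ √C + ‖fracPow lam b ρ w‖ := fun n => by
    refine (norm_sub_le _ _).trans (add_le_add_left (Real.le_sqrt_of_sq_le ?_) _)
    exact (le_add_of_nonneg_left (sq_nonneg _)).trans (hC n)
  have key : ∀ d ∈ (Submodule.span ℝ (Set.range b) : Set (Hs Om)),
      Tendsto (fun n => ⟪fracPow lam b ρ (v n) - fracPow lam b ρ w, d⟫) atTop (𝓝 0) := by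
    intro d hd
    induction hd using Submodule.span_induction with
    | mem x hx =>
      obtain ⟨j, rfl⟩ := hx
      have := ((hlim j).sub_const ⟪w, b j⟫).const_mul (lam j ^ ρ)
      rw [sub_self, mul_zero] at this
      refine this.congr fun n => ?_
      rw [inner_sub_left, inner_fracPow_basis b (hv n), inner_fracPow_basis b hw]
      ring
    | zero => simp
    | add x y _ _ hx hy => simpa [inner_add_right] using hx.add hy
    | smul c x _ hx => simpa [real_inner_smul_right] using hx.const_mul c
  have := (tendsto_inner_of_dense (dense_span_basis b) hbd key k).add_const ⟪fracPow lam b ρ w, k⟫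
  simpa [inner_sub_left] using this

namespace Trajectory

/-- Conservation of the component along the kernel of `A`. -/
lemma inner_basis_zero (h : Trajectory bA bB lamA lamB r σ τ J N u y μ g z) (hr : 0 < r)
    (h0 : lamA 0 = 0) {t : ℝ} (ht : 0 ≤ t) : ⟪bA 0, y t⟫ = ⟪bA 0, y 0⟫ := by
  have := h.weak (bA 0) (inDom_basis bA 0) 0 t le_rfl ht
  rw [fracPow_basis, h0, Real.zero_rpow hr.ne', zero_smul] at this
  simp only [inner_zero_right, intervalIntegral.integral_zero, neg_zero] at this
  rwa [real_inner_comm, real_inner_comm (y 0), ← sub_eq_zero, ← inner_sub_left]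

lemma ae_sq_z_le (h : Trajectory bA bB lamA lamB r σ τ J N u y μ g z) (hτ : τ ∈ Icc (0:ℝ) 1) :
    ∀ᵐ t ∂(volume.restrict (Ioi (0:ℝ))), ‖z t‖ ^ 2 ≤ τ⁻¹ * ‖z t‖ ^ 2 := by
  filter_upwards [h.z_eq] with t ht
  rcases hτ.1.eq_or_lt with rfl | hpos
  · have : z t = 0 := (dense_inDom (lam := lamA) (ρ := r) bA).eq_zero_of_inner_left ℝ
      fun v hv => by rw [ht v hv]; ring
    simp [this]
  · exact le_mul_of_one_le_left (sq_nonneg _) ((one_le_inv₀ hpos).2 hτ.2)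

/-- The elements of the `ω`-limit set solve the stationary problem. -/
lemma exists_limit (h : Trajectory bA bB lamA lamB r σ τ J N u y μ g z)
    (hposA : ∀ j, 0 ≤ lamA j) (hmonoA : Monotone lamA) (hA0 : lamA 0 = 0) (hA1 : 0 < lamA 1)
    (hpos : ∀ j, 0 ≤ lamB j) (hmono : Monotone lamB) (hlam : Tendsto lamB atTop atTop)
    (hr : 0 < r) (hσ : 0 < σ) (hτ : τ ∈ Icc (0:ℝ) 1) (hN : Continuous N)
    (hJ : LowerSemicontinuous J) {a C : ℝ} (ha : 0 < a)
    (hC : ∀ t, a < t → inDom lamB bB σ (y t) ∧ gnormSq lamB bB σ (y t) ≤ C)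
    (hint : IntegrableOn (fun t => ‖g t‖ ^ 2 + τ⁻¹ * ‖z t‖ ^ 2) (Ioi a)) {uinf : Hs Om}
    (hu : IntegrableOn (fun t => ‖u t - uinf‖ ^ 2) (Ioi (0:ℝ))) {v₁ v₂ : Hs Om}
    (hv₁ : inDom lamB bB σ v₁ ∧ J v₁ < ⊤) (hv₂ : inDom lamB bB σ v₂ ∧ J v₂ < ⊤)
    (h₁ : ⟪bA 0, y 0 - v₁⟫ < 0) (h₂ : 0 < ⟪bA 0, y 0 - v₂⟫) {w : Hs Om}
    (hw : w ∈ omegaLimit lamB bB σ y) :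
    ∃ m : ℝ, J w < ⊤ ∧ ∀ v, inDom lamB bB σ v → J v < ⊤ →
      ⟪fracPow lamB bB σ w, fracPow lamB bB σ w - fracPow lamB bB σ v⟫ + (J w).toReal
        + ⟪N w - uinf, w - v⟫ ≤ m * ⟪bA 0, w - v⟫ + (J v).toReal := by
  obtain ⟨hwd, tn, -, -, htop, hconv⟩ := hw
  obtain ⟨n₀, hn₀⟩ := eventually_atTop.1 (htop.eventually_gt_atTop a)
  set t : ℕ → ℝ := fun n => tn (n + n₀) with ht_def
  have hta : ∀ n, a < t n := fun n => hn₀ _ (Nat.le_add_left _ _)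
  have htlim : Tendsto t atTop atTop := (tendsto_add_atTop_iff_nat n₀).2 htop
  have hyt : ∀ j, Tendsto (fun n => ⟪y (t n), bB j⟫) atTop (𝓝 ⟪w, bB j⟫) :=
    tendsto_inner_of_innerFrac bB (fun n => (hC _ (hta n)).1) hwd fun φ hφ =>
      (tendsto_add_atTop_iff_nat (f := fun n => innerFrac lamB bB σ (y (tn n)) φ) n₀).2 (hconv φ hφ)
  have hsub : Ioi a ⊆ Ioi 0 := Ioi_subset_Ioi ha.le
  have hτ' : 0 ≤ τ⁻¹ := inv_nonneg.2 hτ.1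
  set F : ℝ → ℝ := fun t => ‖g t‖ ^ 2 + τ⁻¹ * ‖z t‖ ^ 2 + ‖u t - uinf‖ ^ 2 with hF_def
  have hF : IntegrableOn F (Ioi a) := hint.add (hu.mono_set hsub)
  have hgood := ae_restrict_of_ae_restrict_of_subset hsub
    (h.dom_mu.and (h.J_lt_top.and ((h.ae_sq_z_le hτ).and h.ineq)))
  obtain ⟨s, hs, hFs⟩ := exists_seq_tendsto_zero hF (fun t => by positivity) hgood hta htlim
  have hsa : ∀ n, a < s n := fun n => (hta n).trans (hs n).1.1
  have hs0 : ∀ n, 0 ≤ s n := fun n => ha.le.trans (hsa n).le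
  have hg : Tendsto (fun n => g (s n)) atTop (𝓝 0) := tendsto_zero_of_sq_le hFs fun n => by
    have : 0 ≤ τ⁻¹ * ‖z (s n)‖ ^ 2 + ‖u (s n) - uinf‖ ^ 2 := by positivity
    simp only [hF_def]
    linarith
  have hz : Tendsto (fun n => z (s n)) atTop (𝓝 0) := tendsto_zero_of_sq_le hFs fun n => by
    have h1 : 0 ≤ ‖g (s n)‖ ^ 2 + ‖u (s n) - uinf‖ ^ 2 := by positivity
    have h2 := (hs n).2.2.2.1
    simp only [hF_def]
    linarith
  have hus : Tendsto (fun n => u (s n) - uinf) atTop (𝓝 0) := tendsto_zero_of_sq_le hFs fun n => by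
    exact le_add_of_nonneg_left (by positivity)
  have hus' : Tendsto (fun n => u (s n)) atTop (𝓝 uinf) := by
    simpa using hus.add_const uinf
  have hy_sqrt : ∀ t, a < t → ‖y t‖ ≤ √C := fun t ht => Real.le_sqrt_of_sq_le
    ((le_add_of_nonneg_right (sq_nonneg _)).trans (hC t ht).2)
  have hunit := tendsto_integral_unit_interval hF hta htlim
  have hincr : ∀ d ∈ {v : Hs Om | inDom lamA bA r v},
      Tendsto (fun n => ⟪y (s n) - y (t n), d⟫) atTop (𝓝 0) := by
    intro d hd
    have hlim := hunit.const_mul (‖fracPow lamA bA r d‖ ^ 2)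
    rw [mul_zero] at hlim
    refine tendsto_zero_of_sq_le hlim fun n => ?_
    rw [Real.norm_eq_abs, sq_abs]
    have ht0 : 0 ≤ t n := ha.le.trans (hta n).le
    refine (h.inner_increment_sq_le hd ht0 (hs n).1.1.le).trans ?_
    have hi : IntervalIntegrable F volume (t n) (t n + 1) := by
      rw [intervalIntegrable_iff_integrableOn_Ioc_of_le (by linarith)]
      exact hF.mono_set fun p hp => (hta n).trans hp.1
    have e1 : ∫ p in (t n)..(s n), ‖g p‖ ^ 2 ≤ ∫ p in (t n)..(t n + 1), ‖g p‖ ^ 2 :=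
      intervalIntegral.integral_mono_interval le_rfl (hs n).1.1.le (hs n).1.2.le
        (Eventually.of_forall fun _ => sq_nonneg _)
        (h.intervalIntegrable_sq_g ht0 (by linarith))
    have e2 : ∫ p in (t n)..(t n + 1), ‖g p‖ ^ 2 ≤ ∫ p in (t n)..(t n + 1), F p :=
      intervalIntegral.integral_mono_on (by linarith)
        (h.intervalIntegrable_sq_g ht0 (by linarith)) hi fun p _ => by
          have : 0 ≤ τ⁻¹ * ‖z p‖ ^ 2 + ‖u p - uinf‖ ^ 2 := by positivity
          simp only [hF_def]
          linarith
    have e3 : 0 ≤ ∫ p in (t n)..(s n), ‖g p‖ ^ 2 :=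
      intervalIntegral.integral_nonneg (hs n).1.1.le fun _ _ => sq_nonneg _
    refine mul_le_mul_of_nonneg_left ?_ (sq_nonneg _)
    have := (hs n).1.2
    nlinarith
  have hys : ∀ j, Tendsto (fun n => ⟪y (s n), bB j⟫) atTop (𝓝 ⟪w, bB j⟫) := by
    intro j
    have := (tendsto_inner_of_dense (dense_inDom bA) (C := √C + √C) (fun n =>
      (norm_sub_le _ _).trans (add_le_add (hy_sqrt _ (hsa n)) (hy_sqrt _ (hta n)))) hincr
      (bB j)).add (hyt j)
    simpa [inner_sub_left] using this
  have hyw : Tendsto (fun n => y (s n)) atTop (𝓝 w) :=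
    tendsto_of_gnormSq_le bB hpos hmono hlam hσ (fun n => (hC _ (hsa n)).1)
      (fun n => (hC _ (hsa n)).2) hys
  have hB := tendsto_inner_fracPow bB (fun n => (hC _ (hsa n)).1) (fun n => (hC _ (hsa n)).2) hys
  have hmu : Tendsto (fun n => μ (s n) - ⟪μ (s n), bA 0⟫ • bA 0) atTop (𝓝 0) := by
    have hlim := (hg.norm.pow 2).const_mul (((lamA 1 ^ r) ^ 2)⁻¹)
    rw [norm_zero, zero_pow two_ne_zero, mul_zero] at hlim
    refine tendsto_zero_of_sq_le hlim fun n => ?_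
    have := norm_sub_sq_le_fracPow bA hposA hmonoA hr hA1 (hs n).2.1
    rwa [← h.g_eq] at this
  set B : Hs Om → Hs Om := fracPow lamB bB σ with hB_def
  obtain ⟨m, hm1, hm2⟩ := exists_multiplier (e := bA 0) (y := y 0)
    (m := fun n => ⟪μ (s n), bA 0⟫)
    (D := {v | inDom lamB bB σ v ∧ J v < ⊤})
    (E := fun n v => ⟪μ (s n) - ⟪μ (s n), bA 0⟫ • bA 0, y (s n) - v⟫ + (J v).toReal
      - ⟪z (s n), y (s n) - v⟫ - ⟪N (y (s n)) - u (s n), y (s n) - v⟫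
      - (2 * ⟪B (y (s n)), B w⟫ - ‖B w‖ ^ 2 - ⟪B (y (s n)), B v⟫))
    (E' := fun v => ⟪(0 : Hs Om), w - v⟫ + (J v).toReal
      - ⟪(0 : Hs Om), w - v⟫ - ⟪N w - uinf, w - v⟫
      - (2 * ⟪B w, B w⟫ - ‖B w‖ ^ 2 - ⟪B w, B v⟫))
    hJ hyw (fun n => (hs n).2.2.1) (fun n => h.inner_basis_zero hr hA0 (hs0 n))
    (by
      intro v _
      have hyv := hyw.sub_const v
      exact ((((hmu.inner hyv).add_const _).sub (hz.inner hyv)).sub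
        ((((hN.tendsto w).comp hyw).sub hus').inner hyv)).sub
        ((((hB (B w)).const_mul 2).sub_const _).sub (hB (B v))))
    (by
      intro n v hv
      have h1 := (hs n).2.2.2.2 v hv.1 hv.2
      have h2 : 0 ≤ ‖B (y (s n)) - B w‖ ^ 2 := sq_nonneg _
      rw [norm_sub_sq_real] at h2
      rw [inner_sub_left (μ (s n)), real_inner_smul_left]
      rw [inner_sub_right (B (y (s n))), real_inner_self_eq_norm_sq] at h1
      linarith)
    hv₁ hv₂ h₁ h₂
  refine ⟨m, hm1, fun v hv hJv => ?_⟩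
  have := hm2 v ⟨hv, hJv⟩
  simp only [inner_zero_left, real_inner_self_eq_norm_sq] at this
  rw [inner_sub_right (B w), real_inner_self_eq_norm_sq]
  linarith

end Trajectory

end Trajectories

section Constants

variable {Om : Set E3}

lemma inner_const_left {e : Hs Om} {c : ℝ} (he : ∀ᵐ x ∂(mOm Om), e x = c) (v w : Hs Om) :
    ⟪e, v - w⟫ = c * ∫ x, (v x - w x) ∂(mOm Om) := by
  rw [L2.inner_def, ← integral_const_mul]
  refine integral_congr_ae ?_
  filter_upwards [he, Lp.coeFn_sub v w] with x h1 h2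
  rw [h1, h2, Pi.sub_apply, real_inner_eq_mul]

variable [IsFiniteMeasure (mOm Om)]

lemma inner_sub_const {e v w : Hs Om} {c s : ℝ} (h0 : volume Om ≠ 0)
    (he : ∀ᵐ x ∂(mOm Om), e x = c) (hw : ∀ᵐ x ∂(mOm Om), w x = s) :
    ⟪e, v - w⟫ = c * (volume Om).toReal * (meanVal v - s) := by
  have hfin : volume Om ≠ ⊤ := by
    rw [← Measure.restrict_apply_univ]
    exact measure_ne_top _ _
  have hpos : 0 < (volume Om).toReal := toReal_pos h0 hfin
  have h1 : ∫ x, w x ∂(mOm Om) = (volume Om).toReal * s := by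
    rw [integral_congr_ae hw, integral_const, smul_eq_mul, measureReal_restrict_apply_univ]
    rfl
  rw [inner_const_left he, integral_sub (integrable_coe v) (integrable_coe w), h1, meanVal]
  field_simp

/-- Existence of admissible constants on both sides of the mean value. -/
lemma exists_admissible {e : Hs Om} {c : ℝ} (h0 : volume Om ≠ 0) (hc : c ≠ 0)
    (he : ∀ᵐ x ∂(mOm Om), e x = c) {betah : ℝ → ℝ≥0∞} {D : Set (Hs Om)}
    (hD : ∀ s : ℝ, ∃ w ∈ D, ∀ᵐ x ∂(mOm Om), w x = s) {y : Hs Om}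
    (hy : meanVal y ∈ interior {s : ℝ | (subdiff betah s).Nonempty}) :
    ∃ v₁ v₂ : Hs Om, (v₁ ∈ D ∧ (∫⁻ x, betah (v₁ x) ∂(mOm Om)) < ⊤) ∧
      (v₂ ∈ D ∧ (∫⁻ x, betah (v₂ x) ∂(mOm Om)) < ⊤) ∧ ⟪e, y - v₁⟫ < 0 ∧ 0 < ⟪e, y - v₂⟫ := by
  have hfin : volume Om ≠ ⊤ := by
    rw [← Measure.restrict_apply_univ]
    exact measure_ne_top _ _
  have hpos : 0 < (volume Om).toReal := toReal_pos h0 hfin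
  obtain ⟨δ, hδ, hball⟩ := Metric.mem_nhds_iff.1 (mem_interior_iff_mem_nhds.1 hy)
  have key : ∀ s ∈ Metric.ball (meanVal y) δ, ∃ w ∈ D,
      (∫⁻ x, betah (w x) ∂(mOm Om)) < ⊤ ∧
        ⟪e, y - w⟫ = c * (volume Om).toReal * (meanVal y - s) := by
    intro s hs
    obtain ⟨w, hw, hws⟩ := hD s
    obtain ⟨ξ, hξ⟩ := hball hs
    refine ⟨w, hw, ?_, inner_sub_const h0 he hws⟩
    rw [lintegral_congr_ae (hws.mono fun x hx => by rw [hx]), lintegral_const]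
    exact mul_lt_top hξ.1 (measure_lt_top _ _)
  have hcpos : 0 < |c| := abs_pos.2 hc
  set η := δ / (2 * |c|) with hη
  have hη0 : 0 < η := by positivity
  have hηc : η * |c| < δ := by
    rw [hη]
    field_simp
    linarith
  have hc2 : 0 < c * c := mul_self_pos.2 hc
  obtain ⟨v₁, hv₁, hJ₁, e₁⟩ := key (meanVal y + η * c) (by
    rw [Metric.mem_ball, Real.dist_eq, add_sub_cancel_left, abs_mul, abs_of_pos hη0]
    exact hηc)
  obtain ⟨v₂, hv₂, hJ₂, e₂⟩ := key (meanVal y - η * c) (by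
    rw [Metric.mem_ball, Real.dist_eq, sub_sub_cancel_left, abs_neg, abs_mul, abs_of_pos hη0]
    exact hηc)
  have hprod : 0 < (c * c) * (volume Om).toReal * η := by positivity
  refine ⟨v₁, v₂, ⟨hv₁, hJ₁⟩, ⟨hv₂, hJ₂⟩, ?_, ?_⟩
  · rw [e₁]
    linarith
  · rw [e₂]
    linarith

end Constants

/-- **Theorem 2.2, case `λ₁ = 0`.** Under the structural assumptions and the assumptions
on the data, with `u - u_∞ ∈ L²(0,+∞;H)`, if `λ₁ = 0` then for every element `y_ω` of
the ω-limit set of `y` there exists a real function `μ_∞ ∈ L^∞_loc([0,+∞))` such that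
`(B^σ y_ω, B^σ(y_ω - v)) + ∫_Om β̂(y_ω) + (π(y_ω) - u_∞, y_ω - v)
  ≤ (μ_∞(t), y_ω - v) + ∫_Om β̂(v)`
for every `v ∈ V_B^σ` and a.a. `t ∈ (0,+∞)`, where `μ_∞(t)` acts as the spatially
constant function with value `μ_∞(t)`. -/
theorem omega_limit_characterization_zero
    (Om : Set E3) (lamA lamB : ℕ → ℝ) (eA eB : ℕ → Hs Om) (r σ τ : ℝ)
    (betah : ℝ → ℝ≥0∞) (pih piF : ℝ → ℝ) (Lpi : ℝ≥0)
    (u u' : ℝ → Hs Om) (y0 : Hs Om)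
    (hset : SettingHyps Om lamA lamB eA eB r σ τ)
    (hdata : DataHyps Om lamA lamB eB σ betah pih piF Lpi u u' y0)
    (uinf : Hs Om) (hui : IntegrableOn (fun t => ‖u t - uinf‖ ^ 2) (Set.Ioi (0:ℝ)))
    (y μ : ℝ → Hs Om) (dy : ℝ → Hs Om →ₗ[ℝ] ℝ) (z : ℝ → Hs Om)
    (hsol : IsSolution Om lamA lamB eA eB r σ τ betah piF u y0 y μ dy z)
    (hlam : lamA 0 = 0) :
    ∀ w ∈ omegaLimit lamB eB σ y,
      ∃ μinf : ℝ → ℝ, Measurable μinf ∧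
        (∀ T : ℝ, 0 < T → ∃ C : ℝ,
          ∀ᵐ t ∂(volume.restrict (Set.Ioc (0:ℝ) T)), |μinf t| ≤ C) ∧
        (∫⁻ x, betah (w x) ∂(mOm Om)) < ⊤ ∧
        ∀ᵐ t ∂(volume.restrict (Set.Ioi (0:ℝ))),
          ∀ v : Hs Om, inDom lamB eB σ v → (∫⁻ x, betah (v x) ∂(mOm Om)) < ⊤ →
            ⟪fracPow lamB eB σ w, fracPow lamB eB σ w - fracPow lamB eB σ v⟫
              + (∫⁻ x, betah (w x) ∂(mOm Om)).toReal
              + ∫ x, (piF (w x) - uinf x) * (w x - v x) ∂(mOm Om)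
              ≤ μinf t * ∫ x, (w x - v x) ∂(mOm Om)
                + (∫⁻ x, betah (v x) ∂(mOm Om)).toReal := by
  intro w hw
  obtain ⟨hopen, hconn, hbdd, hposA, hposB, hmonoA, hmonoB, -, hlimB, honA, honB, hspA, hspB, hr,
    hσ, hτ, halt, hconst⟩ := hset
  obtain ⟨-, hlsc, -, hd, hL, ⟨α, hα, hcoer⟩, hu', hu2, -, -, hmean⟩ := hdata
  obtain ⟨-, hA1, c, hc⟩ := halt.resolve_left (by rw [hlam]; exact lt_irrefl _)
  obtain ⟨bA, rfl⟩ : ∃ b : HilbertBasis ℕ ℝ (Hs Om), ⇑b = eA :=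
    ⟨_, HilbertBasis.coe_mk honA hspA.ge⟩
  obtain ⟨bB, rfl⟩ : ∃ b : HilbertBasis ℕ ℝ (Hs Om), ⇑b = eB :=
    ⟨_, HilbertBasis.coe_mk honB hspB.ge⟩
  have hfin : IsFiniteMeasure (mOm Om) :=
    isFiniteMeasure_restrict.2 hbdd.measure_lt_top.ne
  have hvol : volume Om ≠ 0 := (hopen.measure_pos volume hconn.nonempty).ne'
  have hc0 : c ≠ 0 := by
    rintro rfl
    have h0 : bA 0 = 0 := (Lp.eq_zero_iff_ae_eq_zero).2 hc
    have h1 := bA.orthonormal.1 0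
    rw [h0, norm_zero] at h1
    exact zero_ne_one h1
  obtain ⟨N, hN, hNL⟩ := exists_nemytskii (Om := Om) hL
  have htraj := hsol.trajectory hlsc hN
  have hy0 : y 0 = y0 := hsol.2.2.2.2.2.2.2.2.2.2.2.2.2.2.2
  obtain ⟨K, hK⟩ := exists_coercive (Om := Om) hd hL hcoer
  obtain ⟨a, ha, ⟨C, hC⟩, hint⟩ := htraj.exists_global_bound hposB hmonoB hlimB hσ hτ.1
    Lpi.coe_nonneg (continuous_potential hd hL) (potential_taylor hd hL hN) hu' hu2 hα hK
  obtain ⟨v₁, v₂, hv₁, hv₂, h₁, h₂⟩ := exists_admissible (D := {v | inDom lamB bB σ v}) hvol hc0 hc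
    (hconst hlam) (hmean hlam)
  rw [← hy0] at h₁ h₂
  obtain ⟨m, hm1, hm2⟩ := htraj.exists_limit hposA hmonoA hlam hA1 hposB hmonoB hlimB hr hσ hτ
    hNL.continuous (lowerSemicontinuous_lintegral_comp hlsc) ha hC hint hui hv₁ hv₂ h₁ h₂ hw
  refine ⟨fun _ => m * c, measurable_const, fun T _ => ⟨|m * c|, Eventually.of_forall fun _ => le_rfl⟩,
    hm1, Eventually.of_forall fun _ v hv hJ => ?_⟩
  rw [integral_mul_eq_inner hN, mul_assoc, ← inner_const_left hc]
  exact hm2 v hv hJ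

end FracCH
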